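/- There is no Brouwer homeomorphism whose polynomial entropy lies strictly between 1 and 2: for every Brouwer homeomorphism f, either h_pol(f) ≤ 1 or h_pol(f) ≥ 2. -/

import Mathlib

open Filter Topology Set
open scoped ENNReal

/-- `E` is `(n, ε)`-separated for `f`: any two distinct points of `E` are `ε`-apart at some
time `k ∈ {0, …, n-1}`. -/
def IsDynSeparated {X : Type*} [MetricSpace X] (f : X → X) (n : ℕ) (ε : ℝ) (E : Set X) : Prop :=
  ∀ x ∈ E, ∀ y ∈ E, x ≠ y → ∃ k < n, ε < dist (f^[k] x) (f^[k] y)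

/-- `S(n, ε)`: the maximal cardinality of an `(n, ε)`-separated set. -/
noncomputable def maxSep {X : Type*} [MetricSpace X] (f : X → X) (n : ℕ) (ε : ℝ) : ℕ :=
  sSup {m | ∃ E : Finset X, IsDynSeparated f n ε ↑E ∧ E.card = m}

/-- Polynomial entropy `h_pol(f) = lim_{ε → 0} limsup_n (log S(n,ε) / log n)`, a value in
`[0, ∞]`.  Since `ε ↦ limsup_n (log S(n,ε) / log n)` is nonincreasing in `ε`, the limit as
`ε → 0⁺` is the supremum over `ε > 0`. -/
noncomputable def polEntropy {X : Type*} [MetricSpace X] (f : X → X) : ℝ≥0∞ :=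
  ⨆ (ε : ℝ) (_ : 0 < ε),
    Filter.atTop.limsup fun n : ℕ =>
      ENNReal.ofReal (Real.log (maxSep f n ε) / Real.log n)

/-- An injective map `S² = ℝ² ∪ {∞} → ℝ² × ℝ` realizing the one-point compactification of
the plane as a compact subset of `ℝ³` (it is a homeomorphism onto its image, being a
continuous injection from a compact space to a Hausdorff space): `∞ ↦ ((0,0), 0)` and
`w ↦ ((1+‖w‖²)⁻¹ • w, (1+‖w‖²)⁻¹)`. -/
noncomputable def spherePoint : OnePoint (ℝ × ℝ) → (ℝ × ℝ) × ℝ :=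
  fun z => Option.elim z (((0 : ℝ), (0 : ℝ)), (0 : ℝ))
    (fun w => ((1 + ‖w‖ ^ 2)⁻¹ • w, (1 + ‖w‖ ^ 2)⁻¹))

lemma spherePoint_injective : Function.Injective spherePoint := by
  have key_pos : ∀ w : ℝ × ℝ, (0:ℝ) < (1 + ‖w‖ ^ 2)⁻¹ := fun w => by positivity
  intro a b hab
  cases a with
  | infty =>
    cases b with
    | infty => rfl
    | coe w =>
      exfalso
      have h2 := congrArg Prod.snd hab
      simp only [spherePoint, Option.elim] at h2
      exact (ne_of_gt (key_pos w)) h2.symm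
  | coe v =>
    cases b with
    | infty =>
      exfalso
      have h2 := congrArg Prod.snd hab
      simp only [spherePoint, Option.elim] at h2
      exact (ne_of_gt (key_pos v)) h2
    | coe w =>
      have h2 := congrArg Prod.snd hab
      have h1 := congrArg Prod.fst hab
      simp only [spherePoint, Option.elim] at h1 h2
      rw [h2] at h1
      exact congrArg _ (smul_right_injective (ℝ × ℝ) (ne_of_gt (key_pos w)) h1)

/-- A (compatible) metric on the one-point compactification `S² = ℝ² ∪ {∞}`, induced by the
embedding `spherePoint` of `S²` onto a compact subset of `ℝ³`; with it `S²` is a compact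
metric space, and its metric topology is the one-point-compactification topology. -/
noncomputable instance : MetricSpace (OnePoint (ℝ × ℝ)) :=
  MetricSpace.induced spherePoint spherePoint_injective inferInstance

/-- The extension of a plane map to the one-point compactification `S² = ℝ² ∪ {∞}`,
fixing `∞`. -/
def onePointExtend (g : ℝ × ℝ → ℝ × ℝ) : OnePoint (ℝ × ℝ) → OnePoint (ℝ × ℝ) :=
  Option.map g

/-- The translation `T(x,y) = (x+1, y)` of the plane. -/
def planeTranslation : ℝ × ℝ → ℝ × ℝ := fun z => (z.1 + 1, z.2)

/-- A Brouwer homeomorphism: a fixed-point-free homeomorphism of the plane which preserves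
orientation, equivalently is isotopic to the identity: there is a continuous family
`(H t)_{t ∈ [0,1]}` of homeomorphisms of the plane with `H 0 = id` and `H 1 = f`. -/
def IsBrouwer (f : (ℝ × ℝ) ≃ₜ (ℝ × ℝ)) : Prop :=
  (∀ z, f z ≠ z) ∧
  ∃ H : ℝ → (ℝ × ℝ) → (ℝ × ℝ),
    Continuous (fun q : ℝ × (ℝ × ℝ) => H q.1 q.2) ∧
    (∀ t ∈ Set.Icc (0 : ℝ) 1, ∃ g : (ℝ × ℝ) ≃ₜ (ℝ × ℝ), ⇑g = H t) ∧
    H 0 = id ∧ H 1 = ⇑f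

/-! ### Continuous logarithms -/

lemma exists_continuous_log {A : Type*} [TopologicalSpace A] [SimplyConnectedSpace A]
    [LocallyPathConnectedSpace A] {f : A → ℂ} (hf : Continuous f) (h0 : ∀ a, f a ≠ 0) :
    ∃ L : A → ℂ, Continuous L ∧ ∀ a, Complex.exp (L a) = f a := by
  obtain ⟨a₀⟩ := (inferInstance : Nonempty A)
  obtain ⟨F, ⟨-, hF⟩, -⟩ := Complex.isCoveringMapOn_exp.existsUnique_continuousMap_lifts
    ⟨f, hf⟩ (a₀ := a₀) (Complex.exp_log (h0 a₀)) (fun a ↦ h0 a)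
  exact ⟨F, F.continuous, fun a ↦ congrFun hF a⟩

lemma eq_of_continuous_of_exp_eq_one {A : Type*} [TopologicalSpace A] [PreconnectedSpace A]
    {D : A → ℂ} (hD : Continuous D) (h : ∀ a, Complex.exp (D a) = 1) (a b : A) : D a = D b := by
  have key := Complex.isCoveringMap_exp.eq_of_comp_eq hD (continuous_const (y := D b))
    (by ext x; simp [h]) b rfl
  exact congrFun key a

/-! ### A planar intermediate value theorem -/

lemma abs_sub_lt_pi_of_cos_pos {S : Set ℂ} (hS : IsPreconnected S) {θ : ℂ → ℝ}
    (hθ : ContinuousOn θ S) (φ : ℝ) (h : ∀ w ∈ S, 0 < Real.cos (θ w - φ)) {x y : ℂ}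
    (hx : x ∈ S) (hy : y ∈ S) : θ x - θ y < Real.pi := by
  by_contra! hle
  have hsub : Icc (θ y) (θ x) ⊆ θ '' S := hS.intermediate_value hy hx hθ
  set m : ℤ := ⌈(θ y - φ - Real.pi / 2) / Real.pi⌉ with hm
  have hpi := Real.pi_pos
  have h1 : (θ y - φ - Real.pi / 2) / Real.pi ≤ m := Int.le_ceil _
  have h2 : (m : ℝ) < (θ y - φ - Real.pi / 2) / Real.pi + 1 := Int.ceil_lt_add_one _
  rw [div_le_iff₀ hpi] at h1
  have h2' : (m : ℝ) * Real.pi < θ y - φ - Real.pi / 2 + Real.pi := by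
    have := mul_lt_mul_of_pos_right h2 hpi
    rwa [add_mul, div_mul_cancel₀ _ hpi.ne', one_mul] at this
  obtain ⟨w, hw, hwe⟩ := hsub (show φ + Real.pi / 2 + m * Real.pi ∈ Icc (θ y) (θ x) by
    constructor <;> linarith)
  have := h w hw
  rw [hwe, show φ + Real.pi / 2 + m * Real.pi - φ = Real.pi / 2 + m * Real.pi by ring,
    Real.cos_add_int_mul_pi] at this
  simp at this

/-- On a segment joining two corners of a box the angle increases. -/
lemma angle_lt {S : Set ℂ} (hS : IsPreconnected S) {θ : ℂ → ℝ}
    (hθ : ContinuousOn θ S) (φ : ℝ) (h : ∀ w ∈ S, 0 < Real.cos (θ w - φ)) {x y : ℂ}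
    (hx : x ∈ S) (hy : y ∈ S) (hxy : 0 < Real.sin (θ y - θ x)) : θ x < θ y := by
  have h1 := abs_sub_lt_pi_of_cos_pos hS hθ φ h hx hy
  by_contra! hle
  have := Real.sin_nonpos_of_nonpos_of_neg_pi_le (x := θ y - θ x) (by linarith) (by linarith)
  linarith

/-- The Poincaré–Miranda theorem on a box of `ℂ`. -/
lemma exists_zero_of_box {F : ℂ → ℂ} (hF : Continuous F) {R M : ℝ} (hR : 0 < R)
    (hright : ∀ w : ℂ, w.re = R → 0 < (F w).re)
    (hleft : ∀ w : ℂ, w.re = -R → (F w).re < 0)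
    (htop : ∀ w : ℂ, |w.re| ≤ R → w.im = M → 0 < (F w).im)
    (hbot : ∀ w : ℂ, |w.re| ≤ R → w.im = -M → (F w).im < 0) :
    ∃ w, F w = 0 := by
  by_contra! h0
  obtain ⟨L, hLc, hL⟩ := exists_continuous_log hF h0
  set θ : ℂ → ℝ := fun w ↦ (L w).im with hθd
  have hθ : Continuous θ := Complex.continuous_im.comp hLc
  have hre : ∀ w, (F w).re = Real.exp (L w).re * Real.cos (θ w) := fun w ↦ by
    rw [← hL, Complex.exp_re]
  have him : ∀ w, (F w).im = Real.exp (L w).re * Real.sin (θ w) := fun w ↦ by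
    rw [← hL, Complex.exp_im]
  have cpos : ∀ w, 0 < (F w).re → 0 < Real.cos (θ w) := fun w h ↦ by
    rw [hre] at h; exact (mul_pos_iff_of_pos_left (Real.exp_pos _)).1 h
  have spos : ∀ w, 0 < (F w).im → 0 < Real.sin (θ w) := fun w h ↦ by
    rw [him] at h; exact (mul_pos_iff_of_pos_left (Real.exp_pos _)).1 h
  have cneg : ∀ w, (F w).re < 0 → Real.cos (θ w) < 0 := fun w h ↦ by
    rw [hre] at h; exact neg_of_mul_neg_right h (Real.exp_pos _).le
  have sneg : ∀ w, (F w).im < 0 → Real.sin (θ w) < 0 := fun w h ↦ by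
    rw [him] at h; exact neg_of_mul_neg_right h (Real.exp_pos _).le
  have hline : ∀ x : ℝ, IsPreconnected {w : ℂ | w.re = x} := fun x ↦
    (convex_hyperplane (Complex.reLm.isLinear) x).isPreconnected
  have hseg : ∀ y : ℝ, IsPreconnected {w : ℂ | |w.re| ≤ R ∧ w.im = y} := fun y ↦ by
    have h1 : Convex ℝ {w : ℂ | |w.re| ≤ R} := by
      have : {w : ℂ | |w.re| ≤ R} = {w : ℂ | -R ≤ w.re} ∩ {w : ℂ | w.re ≤ R} := by
        ext w; simp [abs_le]
      rw [this]
      exact (convex_halfSpace_ge Complex.reLm.isLinear _).inter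
        (convex_halfSpace_le Complex.reLm.isLinear _)
    exact (h1.inter (convex_hyperplane (Complex.imLm.isLinear) y)).isPreconnected
  have hRR : |R| ≤ R := by rw [abs_of_pos hR]
  have hRR' : |-R| ≤ R := by rw [abs_neg]; exact hRR
  have c1 := cpos ⟨R, -M⟩ (hright _ rfl)
  have s1 := sneg ⟨R, -M⟩ (hbot _ hRR rfl)
  have c2 := cpos ⟨R, M⟩ (hright _ rfl)
  have s2 := spos ⟨R, M⟩ (htop _ hRR rfl)
  have c3 := cneg ⟨-R, M⟩ (hleft _ rfl)
  have s3 := spos ⟨-R, M⟩ (htop _ hRR' rfl)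
  have c4 := cneg ⟨-R, -M⟩ (hleft _ rfl)
  have s4 := sneg ⟨-R, -M⟩ (hbot _ hRR' rfl)
  have a1 : θ ⟨R, -M⟩ < θ ⟨R, M⟩ := by
    refine angle_lt (hline R) hθ.continuousOn 0 (fun w hw ↦ ?_) rfl rfl ?_
    · rw [sub_zero]; exact cpos w (hright w hw)
    · rw [Real.sin_sub]; nlinarith
  have a2 : θ ⟨R, M⟩ < θ ⟨-R, M⟩ := by
    refine angle_lt (hseg M) hθ.continuousOn (Real.pi / 2) (fun w hw ↦ ?_) ⟨hRR, rfl⟩ ⟨hRR', rfl⟩ ?_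
    · rw [Real.cos_sub_pi_div_two]; exact spos w (htop w hw.1 hw.2)
    · rw [Real.sin_sub]; nlinarith
  have a3 : θ ⟨-R, M⟩ < θ ⟨-R, -M⟩ := by
    refine angle_lt (hline (-R)) hθ.continuousOn Real.pi (fun w hw ↦ ?_) rfl rfl ?_
    · rw [Real.cos_sub_pi]; have := cneg w (hleft w hw); linarith
    · rw [Real.sin_sub]; nlinarith
  have a4 : θ ⟨-R, -M⟩ < θ ⟨R, -M⟩ := by
    refine angle_lt (hseg (-M)) hθ.continuousOn (-(Real.pi / 2)) (fun w hw ↦ ?_) ⟨hRR', rfl⟩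
      ⟨hRR, rfl⟩ ?_
    · rw [sub_neg_eq_add, Real.cos_add_pi_div_two]
      have := sneg w (hbot w hw.1 hw.2); linarith
    · rw [Real.sin_sub]; nlinarith
  linarith

/-! ### Isotopies to the identity -/

/-- `f` is joined to the identity by a continuous family of injective maps of `ℂ`. -/
def IsotopicToId (f : ℂ → ℂ) : Prop :=
  ∃ H : ℝ → ℂ → ℂ, Continuous (fun q : ℝ × ℂ ↦ H q.1 q.2) ∧
    (∀ t ∈ Icc (0 : ℝ) 1, Function.Injective (H t)) ∧ H 0 = id ∧ H 1 = f

lemma IsotopicToId.comp {f g : ℂ → ℂ} (hf : IsotopicToId f) (hg : IsotopicToId g) :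
    IsotopicToId (f ∘ g) := by
  obtain ⟨H, hc, hi, h0, h1⟩ := hf
  obtain ⟨K, kc, ki, k0, k1⟩ := hg
  refine ⟨fun t ↦ H t ∘ K t, hc.comp (continuous_fst.prodMk kc),
    fun t ht ↦ (hi t ht).comp (ki t ht), ?_, ?_⟩
  · simp [h0, k0]
  · simp [h1, k1]

/-! ### Brouwer's lemma for points of period two -/

/-- The inverse of the Möbius map `z ↦ (z - a) / (z - b)`. -/
noncomputable def moebiusInv (a b ζ : ℂ) : ℂ := b + (b - a) / (ζ - 1)

lemma moebiusInv_eq (a b : ℂ) : moebiusInv a b = fun ζ ↦ b + (b - a) * (ζ - 1)⁻¹ := by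
  funext ζ
  rw [moebiusInv, div_eq_mul_inv]

lemma moebiusInv_sub_right {a b ζ : ℂ} : moebiusInv a b ζ - b = (b - a) / (ζ - 1) := by
  simp [moebiusInv]

lemma moebiusInv_sub_left {a b ζ : ℂ} (hζ : ζ ≠ 1) :
    moebiusInv a b ζ - a = ζ * ((b - a) / (ζ - 1)) := by
  have : ζ - 1 ≠ 0 := sub_ne_zero.2 hζ
  rw [moebiusInv]
  field_simp
  ring

lemma moebiusInv_ne_right {a b ζ : ℂ} (hab : a ≠ b) (hζ : ζ ≠ 1) : moebiusInv a b ζ ≠ b := by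
  rw [← sub_ne_zero, moebiusInv_sub_right]
  exact div_ne_zero (sub_ne_zero.2 hab.symm) (sub_ne_zero.2 hζ)

lemma moebiusInv_ne_left {a b ζ : ℂ} (hab : a ≠ b) (hζ : ζ ≠ 1) (h0 : ζ ≠ 0) :
    moebiusInv a b ζ ≠ a := by
  rw [← sub_ne_zero, moebiusInv_sub_left hζ]
  exact mul_ne_zero h0 (div_ne_zero (sub_ne_zero.2 hab.symm) (sub_ne_zero.2 hζ))

lemma moebius_moebiusInv {a b ζ : ℂ} (hab : a ≠ b) (hζ : ζ ≠ 1) :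
    (moebiusInv a b ζ - a) / (moebiusInv a b ζ - b) = ζ := by
  rw [moebiusInv_sub_left hζ, moebiusInv_sub_right]
  exact mul_div_cancel_right₀ _ (div_ne_zero (sub_ne_zero.2 hab.symm) (sub_ne_zero.2 hζ))

lemma continuousAt_moebiusInv {a b ζ : ℂ} (hζ : ζ ≠ 1) : ContinuousAt (moebiusInv a b) ζ := by
  unfold moebiusInv
  exact continuousAt_const.add (continuousAt_const.div (continuousAt_id.sub continuousAt_const)
    (sub_ne_zero.2 hζ))

lemma eq_of_moebius_eq {a b z w : ℂ} (hab : a ≠ b) (hz : z ≠ b) (hw : w ≠ b)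
    (h : (z - a) / (z - b) = (w - a) / (w - b)) : z = w := by
  rw [div_eq_div_iff (sub_ne_zero.2 hz) (sub_ne_zero.2 hw)] at h
  have h2 : (b - a) * (z - w) = 0 := by linear_combination -h
  rcases mul_eq_zero.1 h2 with h3 | h3
  · exact absurd (sub_eq_zero.1 h3).symm hab
  · exact sub_eq_zero.1 h3

lemma tendsto_moebius_cobounded (a b : ℂ) :
    Tendsto (fun z : ℂ ↦ (z - a) / (z - b)) (Bornology.cobounded ℂ) (𝓝 1) := by
  have h1 : Tendsto (fun z : ℂ ↦ z - b) (Bornology.cobounded ℂ) (Bornology.cobounded ℂ) :=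
    tendsto_sub_const_cobounded b
  have h2 : Tendsto (fun z : ℂ ↦ 1 + (b - a) * (z - b)⁻¹) (Bornology.cobounded ℂ)
      (𝓝 (1 + (b - a) * 0)) :=
    tendsto_const_nhds.add (tendsto_const_nhds.mul (tendsto_inv₀_cobounded.comp h1))
  rw [mul_zero, add_zero] at h2
  refine h2.congr' ?_
  have : ∀ᶠ z : ℂ in Bornology.cobounded ℂ, z ≠ b := Bornology.eventually_ne_cobounded b
  filter_upwards [this] with z hz
  have := sub_ne_zero.2 hz
  field_simp
  ring

/-- The rotation number of the pair `(f z, f a)` relative to `(f z, f b)` along a loop around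
`a` and `b` is preserved along an isotopy. -/
lemma IsotopicToId.exists_log_loop {f : ℂ → ℂ} (hf : IsotopicToId f) {a b : ℂ} (hab : a ≠ b) :
    ∃ l : ℝ → ℂ, Continuous l ∧
      (∀ s, Complex.exp (l s) =
        (f (moebiusInv a b (Complex.exp (1 + s * Complex.I))) - f a) /
          (f (moebiusInv a b (Complex.exp (1 + s * Complex.I))) - f b)) ∧
      ∀ s : ℝ, l (s + 2 * Real.pi) - l s = 2 * Real.pi * Complex.I := by
  obtain ⟨H, hc, hi, h0, h1⟩ := hf
  set c : ℝ → ℝ := fun t ↦ max 0 (min 1 t) with hcd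
  have hcc : Continuous c := by fun_prop
  have hc01 : ∀ t, c t ∈ Icc (0 : ℝ) 1 := fun t ↦
    ⟨le_max_left _ _, max_le zero_le_one (min_le_left _ _)⟩
  have hne1 : ∀ s : ℝ, Complex.exp (1 + s * Complex.I) ≠ 1 := fun s h ↦ by
    have := congrArg norm h
    rw [Complex.norm_exp] at this
    simp at this
  set z : ℝ → ℂ := fun s ↦ moebiusInv a b (Complex.exp (1 + s * Complex.I)) with hz
  have hzc : Continuous z := continuous_iff_continuousAt.2 fun s ↦
    (continuousAt_moebiusInv (hne1 s)).comp
      (f := fun s : ℝ ↦ Complex.exp (1 + s * Complex.I)) (by fun_prop)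
  have hzper : ∀ s, z (s + 2 * Real.pi) = z s := fun s ↦ by
    simp only [hz]
    congr 1
    rw [show (1 : ℂ) + ((s + 2 * Real.pi : ℝ) : ℂ) * Complex.I
      = (1 + s * Complex.I) + 2 * Real.pi * Complex.I by push_cast; ring, Complex.exp_add,
      Complex.exp_two_pi_mul_I, mul_one]
  have hza : ∀ s, z s ≠ a := fun s ↦ moebiusInv_ne_left hab (hne1 s) (Complex.exp_ne_zero _)
  have hzb : ∀ s, z s ≠ b := fun s ↦ moebiusInv_ne_right hab (hne1 s)
  set K : ℝ × ℝ → ℂ := fun q ↦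
    (H (c q.1) (z q.2) - H (c q.1) a) / (H (c q.1) (z q.2) - H (c q.1) b) with hK
  have n1 : ∀ q : ℝ × ℝ, H (c q.1) (z q.2) - H (c q.1) a ≠ 0 := fun q ↦
    sub_ne_zero.2 ((hi _ (hc01 _)).ne (hza _))
  have n2 : ∀ q : ℝ × ℝ, H (c q.1) (z q.2) - H (c q.1) b ≠ 0 := fun q ↦
    sub_ne_zero.2 ((hi _ (hc01 _)).ne (hzb _))
  have hcz : Continuous fun q : ℝ × ℝ ↦ H (c q.1) (z q.2) :=
    hc.comp (f := fun q : ℝ × ℝ ↦ (c q.1, z q.2)) (by fun_prop)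
  have hcx : ∀ x : ℂ, Continuous fun q : ℝ × ℝ ↦ H (c q.1) x := fun x ↦
    hc.comp (f := fun q : ℝ × ℝ ↦ (c q.1, x)) (by fun_prop)
  have hKc : Continuous K := (hcz.sub (hcx a)).div (hcz.sub (hcx b)) n2
  obtain ⟨L, hLc, hL⟩ := exists_continuous_log hKc fun q ↦ div_ne_zero (n1 q) (n2 q)
  have hc0 : c 0 = 0 := by simp [hcd]
  have hc1 : c 1 = 1 := by simp [hcd]
  have hD : ∀ p q : ℝ × ℝ, L (p.1, p.2 + 2 * Real.pi) - L p = L (q.1, q.2 + 2 * Real.pi) - L q := by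
    refine eq_of_continuous_of_exp_eq_one
      (D := fun p : ℝ × ℝ ↦ L (p.1, p.2 + 2 * Real.pi) - L p) (by fun_prop) fun p ↦ ?_
    rw [Complex.exp_sub, hL, hL]
    simp only [hK, hzper]
    exact div_self (div_ne_zero (n1 p) (n2 p))
  have hstart : ∀ s s' : ℝ, L (0, s) - (1 + s * Complex.I) = L (0, s') - (1 + s' * Complex.I) := by
    refine eq_of_continuous_of_exp_eq_one
      (D := fun s : ℝ ↦ L (0, s) - (1 + s * Complex.I)) (by fun_prop) fun s ↦ ?_
    rw [Complex.exp_sub, hL]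
    simp only [hK, hc0, h0, id, hz]
    rw [moebius_moebiusInv hab (hne1 s)]
    exact div_self (Complex.exp_ne_zero _)
  refine ⟨fun s ↦ L (1, s), by fun_prop, fun s ↦ ?_, fun s ↦ ?_⟩
  · rw [hL]; simp only [hK, hc1, h1, hz]
  · have e1 := hD (1, s) (0, s)
    have e2 := hstart (s + 2 * Real.pi) s
    simp only at e1
    rw [e1]
    push_cast at e2
    linear_combination e2

theorem exists_fixedPoint_of_swap (f : ℂ ≃ₜ ℂ) (hf : IsotopicToId f) {a b : ℂ} (hab : a ≠ b)
    (ha : f a = b) (hb : f b = a) : ∃ z, f z = z := by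
  classical
  have hpi := Real.pi_pos
  set g : ℂ → ℂ := fun ζ ↦ if ζ = 1 then 1 else
    (f (moebiusInv a b ζ) - a) / (f (moebiusInv a b ζ) - b) with hg
  have hg1 : g 1 = 1 := by simp [hg]
  have hgz : ∀ ζ, ζ ≠ 1 →
      g ζ = (f (moebiusInv a b ζ) - a) / (f (moebiusInv a b ζ) - b) := fun ζ h ↦ by simp [hg, h]
  have na : ∀ ζ, ζ ≠ 1 → f (moebiusInv a b ζ) - a ≠ 0 := fun ζ h ↦ by
    rw [sub_ne_zero]; nth_rw 2 [← hb]; exact f.injective.ne (moebiusInv_ne_right hab h)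
  have nb : ∀ ζ, ζ ≠ 1 → ζ ≠ 0 → f (moebiusInv a b ζ) - b ≠ 0 := fun ζ h h' ↦ by
    rw [sub_ne_zero]; nth_rw 2 [← ha]; exact f.injective.ne (moebiusInv_ne_left hab h h')
  have hgne : ∀ ζ, ζ ≠ 0 → g ζ ≠ 0 := fun ζ h0 ↦ by
    by_cases h : ζ = 1
    · rw [h, hg1]; exact one_ne_zero
    · rw [hgz ζ h]; exact div_ne_zero (na ζ h) (nb ζ h h0)
  have hgc : ∀ ζ, ζ ≠ 0 → ContinuousAt g ζ := fun ζ h0 ↦ by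
    by_cases h : ζ = 1
    · subst h
      rw [continuousAt_iff_punctured_nhds, hg1]
      have e1 : Tendsto (fun ζ : ℂ ↦ (ζ - 1)⁻¹) (𝓝[≠] 1) (Bornology.cobounded ℂ) := by
        refine tendsto_inv₀_nhdsNE_zero.comp ?_
        refine tendsto_nhdsWithin_iff.2 ⟨?_, ?_⟩
        · have : Tendsto (fun ζ : ℂ ↦ ζ - 1) (𝓝 1) (𝓝 (1 - 1)) := by
            exact (continuous_id.sub continuous_const).tendsto _
          rw [sub_self] at this
          exact this.mono_left nhdsWithin_le_nhds
        · filter_upwards [self_mem_nhdsWithin] with x hx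
          exact sub_ne_zero.2 hx
      have e2 : Tendsto (moebiusInv a b) (𝓝[≠] 1) (Bornology.cobounded ℂ) := by
        rw [moebiusInv_eq]
        exact (tendsto_const_add_cobounded b).comp
            ((Filter.tendsto_mul_left_cobounded (sub_ne_zero.2 hab.symm)).comp e1)
      have e3 : Tendsto f (Bornology.cobounded ℂ) (Bornology.cobounded ℂ) := by
        rw [Metric.cobounded_eq_cocompact]
        exact f.isClosedEmbedding.tendsto_cocompact
      refine ((tendsto_moebius_cobounded a b).comp (e3.comp e2)).congr' ?_
      filter_upwards [self_mem_nhdsWithin] with x hx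
      exact (hgz x hx).symm
    · have : g =ᶠ[𝓝 ζ] fun ζ ↦ (f (moebiusInv a b ζ) - a) / (f (moebiusInv a b ζ) - b) := by
        filter_upwards [isOpen_ne.mem_nhds h] with x hx using hgz x hx
      rw [continuousAt_congr this]
      have hfm : ContinuousAt (fun ζ ↦ f (moebiusInv a b ζ)) ζ :=
        f.continuous.continuousAt.comp (continuousAt_moebiusInv h)
      exact (hfm.sub continuousAt_const).div (hfm.sub continuousAt_const) (nb ζ h h0)
  obtain ⟨G, hGc, hG⟩ := exists_continuous_log (f := fun w ↦ g (Complex.exp w))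
    (continuous_iff_continuousAt.2 fun w ↦
      (hgc _ (Complex.exp_ne_zero w)).comp Complex.continuous_exp.continuousAt)
    fun w ↦ hgne _ (Complex.exp_ne_zero w)
  -- the lift has degree `-1`
  obtain ⟨l, hlc, hl, hlper⟩ := hf.exists_log_loop hab
  have hne1 : ∀ s : ℝ, Complex.exp (1 + s * Complex.I) ≠ 1 := fun s h ↦ by
    have := congrArg norm h
    rw [Complex.norm_exp] at this
    simp at this
  have hsum : ∀ s s' : ℝ, l s + G (1 + s * Complex.I) = l s' + G (1 + s' * Complex.I) := by
    refine eq_of_continuous_of_exp_eq_one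
      (D := fun s : ℝ ↦ l s + G (1 + s * Complex.I)) (by fun_prop) fun s ↦ ?_
    have n1 := na _ (hne1 s)
    have n2 := nb _ (hne1 s) (Complex.exp_ne_zero _)
    rw [Complex.exp_add, hl, hG, hgz _ (hne1 s), ha, hb]
    field_simp
  have hDc : ∀ w w' : ℂ, G (w + 2 * Real.pi * Complex.I) - G w
      = G (w' + 2 * Real.pi * Complex.I) - G w' := by
    refine eq_of_continuous_of_exp_eq_one
      (D := fun w : ℂ ↦ G (w + 2 * Real.pi * Complex.I) - G w) (by fun_prop) fun w ↦ ?_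
    rw [Complex.exp_sub, hG, hG, Complex.exp_add, Complex.exp_two_pi_mul_I, mul_one]
    exact div_self (hgne _ (Complex.exp_ne_zero _))
  have hper : ∀ w, G (w + 2 * Real.pi * Complex.I) = G w - 2 * Real.pi * Complex.I := fun w ↦ by
    have e1 := hDc w 1
    have e2 := hsum (2 * Real.pi) 0
    have e3 := hlper 0
    simp only [zero_add, Complex.ofReal_zero, zero_mul, add_zero] at e2 e3
    push_cast at e2
    linear_combination e1 + e2 - e3
  -- behaviour at the two ends
  have hz0 : moebiusInv a b 0 = a := by simp [moebiusInv, div_neg]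
  have hend0 : ∀ᶠ ζ in 𝓝[≠] (0 : ℂ), 1 < ‖g ζ‖ := by
    have hm : Tendsto (fun ζ ↦ f (moebiusInv a b ζ)) (𝓝 0) (𝓝 b) := by
      have := (f.continuous.continuousAt.comp
        (continuousAt_moebiusInv (a := a) (b := b) zero_ne_one)).tendsto
      simpa [Function.comp_def, hz0, ha] using this
    have h1 : Tendsto (fun ζ ↦ ‖f (moebiusInv a b ζ) - a‖ - ‖f (moebiusInv a b ζ) - b‖) (𝓝 0)
        (𝓝 (‖b - a‖ - ‖b - b‖)) :=
      (hm.sub_const a).norm.sub (hm.sub_const b).norm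
    have h2 : 0 < ‖b - a‖ - ‖b - b‖ := by
      simpa [sub_eq_zero] using hab.symm
    have h3 := h1.eventually (lt_mem_nhds h2)
    have h4 : ∀ᶠ ζ in 𝓝 (0 : ℂ), ζ ≠ 1 := isOpen_ne.mem_nhds zero_ne_one
    filter_upwards [nhdsWithin_le_nhds h3, nhdsWithin_le_nhds h4, self_mem_nhdsWithin]
      with ζ h h' h''
    rw [hgz ζ h', norm_div, one_lt_div (norm_pos_iff.2 (nb ζ h' h''))]
    linarith
  have hendinf : ∀ᶠ ζ in Bornology.cobounded ℂ, ‖g ζ‖ < 1 := by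
    have h0 : Tendsto (fun ζ : ℂ ↦ ζ - 1) (Bornology.cobounded ℂ) (Bornology.cobounded ℂ) :=
      tendsto_sub_const_cobounded 1
    have hm' : Tendsto (moebiusInv a b) (Bornology.cobounded ℂ) (𝓝 b) := by
      have : Tendsto (fun ζ : ℂ ↦ b + (b - a) * (ζ - 1)⁻¹) (Bornology.cobounded ℂ)
          (𝓝 (b + (b - a) * 0)) :=
        tendsto_const_nhds.add (tendsto_const_nhds.mul (tendsto_inv₀_cobounded.comp h0))
      rwa [← moebiusInv_eq, mul_zero, add_zero] at this
    have hm : Tendsto (fun ζ ↦ f (moebiusInv a b ζ)) (Bornology.cobounded ℂ) (𝓝 a) := by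
      have := (f.continuous.tendsto b).comp hm'
      rwa [hb] at this
    have h1 : Tendsto (fun ζ ↦ ‖f (moebiusInv a b ζ) - b‖ - ‖f (moebiusInv a b ζ) - a‖)
        (Bornology.cobounded ℂ) (𝓝 (‖a - b‖ - ‖a - a‖)) :=
      (hm.sub_const b).norm.sub (hm.sub_const a).norm
    have h2 : 0 < ‖a - b‖ - ‖a - a‖ := by
      simpa [sub_eq_zero] using hab
    filter_upwards [h1.eventually (lt_mem_nhds h2), Bornology.eventually_ne_cobounded (0 : ℂ),
      Bornology.eventually_ne_cobounded (1 : ℂ)] with ζ h h' h''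
    rw [hgz ζ h'', norm_div, div_lt_one (norm_pos_iff.2 (nb ζ h'' h'))]
    linarith
  obtain ⟨δ, hδ, hδ'⟩ := Metric.mem_nhdsWithin_iff.1 hend0
  obtain ⟨ρ, -, hρ⟩ := (hasBasis_cobounded_norm (E := ℂ)).eventually_iff.1 hendinf
  obtain ⟨R, hR0, hRρ, hRδ⟩ : ∃ R : ℝ, 0 < R ∧ ρ ≤ Real.exp R ∧ Real.exp (-R) < δ := by
    have e1 : ∀ᶠ R : ℝ in atTop, ρ ≤ Real.exp R := Real.tendsto_exp_atTop.eventually_ge_atTop ρ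
    have e2 : ∀ᶠ R : ℝ in atTop, Real.exp (-R) < δ :=
      (Real.tendsto_exp_neg_atTop_nhds_zero).eventually (gt_mem_nhds hδ)
    obtain ⟨R, h1, h2, h3⟩ := ((eventually_gt_atTop 0).and (e1.and e2)).exists
    exact ⟨R, h1, h2, h3⟩
  have hnormG : ∀ w, Real.exp (G w).re = ‖g (Complex.exp w)‖ := fun w ↦ by
    rw [← hG, Complex.norm_exp]
  have hRe0 : (G 0).re = 0 := by
    have := hnormG 0
    simpa [hg1] using this
  have hright : ∀ w : ℂ, w.re = R → (G w).re < 0 := fun w hw ↦ by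
    rw [← Real.exp_lt_one_iff, hnormG]
    apply hρ
    simpa [Complex.norm_exp, hw] using hRρ
  have hleft : ∀ w : ℂ, w.re = -R → 0 < (G w).re := fun w hw ↦ by
    rw [← Real.one_lt_exp_iff, hnormG]
    refine hδ' ⟨?_, Complex.exp_ne_zero _⟩
    simpa [Complex.norm_exp, hw] using hRδ
  -- bound of the periodic function `w ↦ Im (G w + w)` on a vertical strip
  have hperZ : ∀ (m : ℤ) (w : ℂ), G (w + m * (2 * Real.pi * Complex.I))
      = G w - m * (2 * Real.pi * Complex.I) := by
    have hN : ∀ (m : ℕ) (w : ℂ), G (w + m * (2 * Real.pi * Complex.I))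
        = G w - m * (2 * Real.pi * Complex.I) := fun m ↦ by
      induction m with
      | zero => simp
      | succ m ih =>
        intro w
        have := hper (w + m * (2 * Real.pi * Complex.I))
        rw [ih] at this
        push_cast
        rw [show w + ((m : ℂ) + 1) * (2 * Real.pi * Complex.I)
          = w + m * (2 * Real.pi * Complex.I) + 2 * Real.pi * Complex.I by ring, this]
        ring
    intro m w
    obtain ⟨n, rfl | rfl⟩ := m.eq_nat_or_neg
    · exact_mod_cast hN n w
    · have := hN n (w + ((-n : ℤ) : ℂ) * (2 * Real.pi * Complex.I))
      push_cast at this ⊢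
      rw [show w + -(n : ℂ) * (2 * Real.pi * Complex.I) + n * (2 * Real.pi * Complex.I) = w by ring]
        at this
      rw [this]; ring
  obtain ⟨C, hC⟩ : ∃ C : ℝ, ∀ w : ℂ, |w.re| ≤ R → |(G w).im + w.im| ≤ C := by
    have hcomp : IsCompact (Icc (-R) R ×ℂ Icc 0 (2 * Real.pi)) :=
      isCompact_Icc.reProdIm isCompact_Icc
    obtain ⟨C, hC⟩ := hcomp.exists_bound_of_continuousOn
      (f := fun w ↦ (G w).im + w.im) (by fun_prop)
    refine ⟨C, fun w hw ↦ ?_⟩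
    have h2pi : (0 : ℝ) < 2 * Real.pi := by positivity
    set m : ℤ := ⌊w.im / (2 * Real.pi)⌋ with hm
    have m1 : (m : ℝ) * (2 * Real.pi) ≤ w.im := (le_div_iff₀ h2pi).1 (Int.floor_le _)
    have m2 : w.im < ((m : ℝ) + 1) * (2 * Real.pi) := (div_lt_iff₀ h2pi).1 (Int.lt_floor_add_one _)
    have him : (((-m : ℤ) : ℂ) * (2 * Real.pi * Complex.I)).im = -m * (2 * Real.pi) := by simp
    have hre : (((-m : ℤ) : ℂ) * (2 * Real.pi * Complex.I)).re = 0 := by simp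
    have := hC (w + ((-m : ℤ) : ℂ) * (2 * Real.pi * Complex.I)) (by
      rw [Complex.mem_reProdIm, Complex.add_re, Complex.add_im, him, hre, add_zero]
      exact ⟨abs_le.1 hw, by constructor <;> linarith⟩)
    rw [hperZ, Complex.sub_im, Complex.add_im, him, Real.norm_eq_abs] at this
    convert this using 2
    ring
  obtain ⟨w₀, hw₀⟩ := exists_zero_of_box
    (F := fun w ↦ w - (G w - G 0 + 2 * Real.pi * Complex.I)) (by fun_prop) hR0
    (M := |C| + |(G 0).im| + 2 * Real.pi)
    (fun w hw ↦ by
      have := hright w hw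
      simp [hw, hRe0]; linarith)
    (fun w hw ↦ by
      have := hleft w hw
      simp [hw, hRe0]; linarith)
    (fun w hw hw' ↦ by
      have := abs_le.1 (hC w hw)
      have h1 := le_abs_self C
      have h2 := neg_abs_le (G 0).im
      have h3 := abs_nonneg C
      have h4 := abs_nonneg (G 0).im
      rw [hw'] at this
      simp [hw']; linarith)
    (fun w hw hw' ↦ by
      have := abs_le.1 (hC w hw)
      have h1 := le_abs_self C
      have h2 := le_abs_self (G 0).im
      have h3 := abs_nonneg C
      have h4 := abs_nonneg (G 0).im
      rw [hw'] at this
      simp [hw']; linarith)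
  have hw₁ : G w₀ - G 0 + 2 * Real.pi * Complex.I = w₀ := (sub_eq_zero.1 hw₀).symm
  have hfix : g (Complex.exp w₀) = Complex.exp w₀ := by
    conv_rhs => rw [← hw₁, Complex.exp_add, Complex.exp_sub, hG, hG]
    simp [hg1, Complex.exp_two_pi_mul_I]
  by_cases h1 : Complex.exp w₀ = 1
  · exfalso
    obtain ⟨m, hm⟩ := Complex.exp_eq_one_iff.1 h1
    have := hperZ m 0
    rw [zero_add, ← hm] at this
    rw [this, hm] at hw₁
    have h2 : (2 * Real.pi * Complex.I) * (2 * (m : ℂ) - 1) = 0 := by linear_combination -hw₁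
    rcases mul_eq_zero.1 h2 with h3 | h3
    · exact Complex.two_pi_I_ne_zero h3
    · have h4 : (2 * m - 1 : ℤ) = 0 := by exact_mod_cast h3
      omega
  · refine ⟨moebiusInv a b (Complex.exp w₀), ?_⟩
    rw [hgz _ h1] at hfix
    exact eq_of_moebius_eq hab (sub_ne_zero.1 (nb _ h1 (Complex.exp_ne_zero _)))
      (moebiusInv_ne_right hab h1) (hfix.trans (moebius_moebiusInv hab h1).symm)

/-! ### Moving points inside open sets -/

/-- `b` is the image of `a` under a homeomorphism isotopic to the identity which is the identity
outside `O`. -/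
def MovesIn (O : Set ℂ) (a b : ℂ) : Prop :=
  ∃ g : ℂ ≃ₜ ℂ, IsotopicToId g ∧ (∀ x, x ∉ O → g x = x) ∧ g a = b

lemma MovesIn.trans {O : Set ℂ} {a b c : ℂ} (hab : MovesIn O a b) (hbc : MovesIn O b c) :
    MovesIn O a c := by
  obtain ⟨g, hg, hgO, rfl⟩ := hab
  obtain ⟨h, hh, hhO, rfl⟩ := hbc
  exact ⟨g.trans h, hh.comp hg, fun x hx ↦ by simp [hgO x hx, hhO x hx], rfl⟩

/-- The perturbation of the identity pushing `c` in the direction `v`, supported in `ball c r`. -/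
noncomputable def bumpMove (c v : ℂ) (r t : ℝ) (x : ℂ) : ℂ :=
  x + (t * max 0 (1 - ‖x - c‖ / r)) • v

lemma continuous_bumpMove (c v : ℂ) (r : ℝ) :
    Continuous (fun q : ℝ × ℂ ↦ bumpMove c v r q.1 q.2) := by
  unfold bumpMove
  fun_prop

lemma norm_bumpMove_sub_le {c v : ℂ} {r t : ℝ} (hr : 0 < r) (ht : t ∈ Icc (0 : ℝ) 1) (x y : ℂ) :
    ‖bumpMove c v r t x - bumpMove c v r t y - (x - y)‖ ≤ ‖v‖ / r * ‖x - y‖ := by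
  have h1 : bumpMove c v r t x - bumpMove c v r t y - (x - y) =
      (t * (max 0 (1 - ‖x - c‖ / r) - max 0 (1 - ‖y - c‖ / r))) • v := by
    simp only [bumpMove, mul_sub, sub_smul]
    ring
  have h2 : |max 0 (1 - ‖x - c‖ / r) - max 0 (1 - ‖y - c‖ / r)| ≤ ‖x - y‖ / r := by
    rw [max_comm 0, max_comm 0]
    refine (abs_max_sub_max_le_abs _ _ _).trans ?_
    have : 1 - ‖x - c‖ / r - (1 - ‖y - c‖ / r) = (‖y - c‖ - ‖x - c‖) / r := by ring
    rw [this, abs_div, abs_of_pos hr]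
    gcongr
    refine (abs_norm_sub_norm_le _ _).trans ?_
    rw [sub_sub_sub_cancel_right, norm_sub_rev]
  rw [h1, norm_smul, Real.norm_eq_abs, abs_mul, abs_of_nonneg ht.1]
  calc t * |max 0 (1 - ‖x - c‖ / r) - max 0 (1 - ‖y - c‖ / r)| * ‖v‖
      ≤ 1 * (‖x - y‖ / r) * ‖v‖ := by
        gcongr
        exact ht.2
    _ = ‖v‖ / r * ‖x - y‖ := by ring

lemma movesIn_of_ball_subset {O : Set ℂ} {b c : ℂ} {r : ℝ} (hO : Metric.ball c r ⊆ O)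
    (hb : b ∈ Metric.ball c r) : MovesIn O c b := by
  have hbr : ‖b - c‖ < r := by simpa [dist_eq_norm] using hb
  have hr : 0 < r := (norm_nonneg _).trans_lt hbr
  have hlt : ‖b - c‖ / r < 1 := (div_lt_one hr).2 hbr
  set k : NNReal := ⟨‖b - c‖ / r, by positivity⟩ with hk
  have hA : ApproximatesLinearOn (bumpMove c (b - c) r 1)
      ((ContinuousLinearEquiv.refl ℝ ℂ : ℂ ≃L[ℝ] ℂ) : ℂ →L[ℝ] ℂ) univ k := fun x _ y _ ↦
    norm_bumpMove_sub_le hr ⟨zero_le_one, le_rfl⟩ x y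
  have hk1 : Subsingleton ℂ ∨
      k < ‖((ContinuousLinearEquiv.refl ℝ ℂ).symm : ℂ →L[ℝ] ℂ)‖₊⁻¹ := by
    right
    rw [← NNReal.coe_lt_coe]
    simp only [NNReal.coe_inv, coe_nnnorm, ContinuousLinearEquiv.refl_symm,
      ContinuousLinearEquiv.coe_refl, ContinuousLinearMap.norm_id, inv_one]
    exact hlt
  refine ⟨hA.toHomeomorph _ hk1, ⟨bumpMove c (b - c) r, continuous_bumpMove _ _ _, ?_, ?_, rfl⟩,
    ?_, ?_⟩
  · intro t ht x y hxy
    have := norm_bumpMove_sub_le (c := c) (v := b - c) hr ht x y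
    rw [hxy, sub_self, zero_sub, norm_neg] at this
    by_contra hne
    have hpos : 0 < ‖x - y‖ := norm_pos_iff.2 (sub_ne_zero.2 hne)
    nlinarith
  · funext x
    simp [bumpMove]
  · intro x hx
    change bumpMove c (b - c) r 1 x = x
    have : r ≤ ‖x - c‖ := by
      by_contra! h
      exact hx (hO (by simpa [dist_eq_norm] using h))
    have : 1 ≤ ‖x - c‖ / r := (one_le_div hr).2 this
    rw [bumpMove, max_eq_left (by linarith)]
    simp
  · change bumpMove c (b - c) r 1 c = b
    simp [bumpMove]

lemma IsPreconnected.movesIn {O : Set ℂ} (hc : IsPreconnected O) (hO : IsOpen O) {a b : ℂ}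
    (ha : a ∈ O) (hb : b ∈ O) : MovesIn O a b := by
  have key : ∀ c ∈ O, ∃ r > 0, ∀ x ∈ Metric.ball c r, x ∈ O ∧ MovesIn O c x ∧ MovesIn O x c := by
    intro c hcO
    obtain ⟨r, hr, hrO⟩ := Metric.isOpen_iff.1 hO c hcO
    refine ⟨r / 2, by positivity, fun x hx ↦ ?_⟩
    rw [Metric.mem_ball] at hx
    refine ⟨hrO (by rw [Metric.mem_ball]; linarith), movesIn_of_ball_subset hrO
      (by rw [Metric.mem_ball]; linarith), movesIn_of_ball_subset (r := r / 2) ?_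
      (by rwa [Metric.mem_ball, dist_comm])⟩
    exact (Metric.ball_subset_ball' (by linarith)).trans hrO
  by_contra hab
  have h1 : IsOpen {x | x ∈ O ∧ MovesIn O a x} := by
    refine Metric.isOpen_iff.2 fun x hx ↦ ?_
    obtain ⟨r, hr, h⟩ := key x hx.1
    exact ⟨r, hr, fun y hy ↦ ⟨(h y hy).1, hx.2.trans (h y hy).2.1⟩⟩
  have h2 : IsOpen {x | x ∈ O ∧ ¬ MovesIn O a x} := by
    refine Metric.isOpen_iff.2 fun x hx ↦ ?_
    obtain ⟨r, hr, h⟩ := key x hx.1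
    exact ⟨r, hr, fun y hy ↦ ⟨(h y hy).1, fun hay ↦ hx.2 (hay.trans (h y hy).2.2)⟩⟩
  obtain ⟨x, -, hx1, hx2⟩ := hc _ _ h1 h2 (fun x hx ↦ by
      by_cases h : MovesIn O a x
      · exact Or.inl ⟨hx, h⟩
      · exact Or.inr ⟨hx, h⟩) ⟨a, ha, ha, by
        obtain ⟨r, hr, h⟩ := key a ha
        exact (h a (Metric.mem_ball_self hr)).2.1⟩ ⟨b, hb, hb, hab⟩
  exact hx2.2 hx1.2

lemma isPreconnected_ball_diff_finite (c : ℂ) (r : ℝ) {s : Set ℂ} (hs : s.Finite) :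
    IsPreconnected (Metric.ball c r \ s) := by
  rcases le_or_gt r 0 with hr | hr
  · rw [Metric.ball_eq_empty.2 hr, empty_sdiff]
    exact isPreconnected_empty
  set u := OpenPartialHomeomorph.univBall c r
  have hinj : Function.Injective u := by
    have := u.injOn
    rwa [OpenPartialHomeomorph.univBall_source, injOn_univ] at this
  have hr2 : u '' univ = Metric.ball c r := by
    rw [← OpenPartialHomeomorph.univBall_target c hr, ← u.image_source_eq_target,
      OpenPartialHomeomorph.univBall_source]
  have : Metric.ball c r \ s = u '' (u ⁻¹' s)ᶜ := by
    rw [← hr2, compl_eq_univ_sdiff, image_sdiff hinj, image_preimage_eq_inter_range,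
      ← image_univ]
    ext x
    simp only [Set.mem_sdiff, mem_inter_iff]
    tauto
  rw [this]
  refine IsPreconnected.image ?_ _ (OpenPartialHomeomorph.continuous_univBall c r).continuousOn
  refine (Set.Countable.isConnected_compl_of_one_lt_rank ?_
    (hs.preimage hinj.injOn).countable).isPreconnected
  rw [Complex.rank_real_complex]
  exact Cardinal.one_lt_two

/-! ### Brouwer homeomorphisms have no periodic points -/

/-- A fixed-point-free homeomorphism of `ℂ` isotopic to the identity. -/
def IsBrouwerC (f : ℂ ≃ₜ ℂ) : Prop := (∀ z, f z ≠ z) ∧ IsotopicToId f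

lemma eq_or_mem_of_support {g : ℂ ≃ₜ ℂ} {O : Set ℂ} (hg : ∀ x, x ∉ O → g x = x) (x : ℂ) :
    g x = x ∨ x ∈ O ∧ g x ∈ O := by
  by_cases hx : x ∈ O
  · by_cases hgx : g x ∈ O
    · exact Or.inr ⟨hx, hgx⟩
    · exact Or.inl (g.injective (hg _ hgx))
  · exact Or.inl (hg _ hx)

lemma iterate_comp_of_fixed_lt {α : Type*} {g f : α → α} {z : α} {j : ℕ}
    (h : ∀ i, 0 < i → i < j → g (f^[i] z) = f^[i] z) : ∀ i < j, (g ∘ f)^[i] z = f^[i] z := by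
  intro i hi
  induction i with
  | zero => rfl
  | succ i ih =>
    rw [Function.iterate_succ_apply', ih (by omega), Function.comp_apply,
      ← Function.iterate_succ_apply' f, h _ (by omega) hi]

lemma iterate_comp_of_fixed {α : Type*} {g f : α → α} {z : α} {j : ℕ} (hj : 0 < j)
    (h : ∀ i, 0 < i → i < j → g (f^[i] z) = f^[i] z) : (g ∘ f)^[j] z = g (f^[j] z) := by
  obtain ⟨i, rfl⟩ : ∃ i, j = i + 1 := ⟨j - 1, by omega⟩
  rw [Function.iterate_succ_apply', iterate_comp_of_fixed_lt h i (by omega), Function.comp_apply,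
    ← Function.iterate_succ_apply' f]

lemma IsBrouwerC.exists_periodic_of_return {f : ℂ ≃ₜ ℂ} (hf : IsBrouwerC f) {D : Set ℂ}
    (hDo : IsOpen D) (hDc : IsPreconnected D) (hD : ∀ z ∈ D, f z ∉ D) {z : ℂ} (hz : z ∈ D) {j : ℕ}
    (hj : 0 < j) (hr : f^[j] z ∈ D) :
    ∃ f' : ℂ ≃ₜ ℂ, IsBrouwerC f' ∧ ∃ i p, 0 < i ∧ i ≤ j ∧ f'^[i] p = p := by
  classical
  have hex : ∃ i, 0 < i ∧ f^[i] z ∈ D := ⟨j, hj, hr⟩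
  set i := Nat.find hex with hi
  obtain ⟨hi0, hiD⟩ := Nat.find_spec hex
  obtain ⟨g, hg, hgD, hgz⟩ := hDc.movesIn hDo hiD hz
  refine ⟨f.trans g, ⟨fun w hw ↦ ?_, hg.comp hf.2⟩, i, z, hi0, Nat.find_min' hex ⟨hj, hr⟩, ?_⟩
  · rcases eq_or_mem_of_support hgD (f w) with h | ⟨h, h'⟩
    · exact hf.1 w (h.symm.trans hw)
    · exact hD w (by rw [← hw]; exact h') h
  · change (g ∘ f)^[_] z = z
    rw [iterate_comp_of_fixed hi0 ?_]
    · exact hgz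
    · intro l hl hli
      exact hgD _ fun h ↦ Nat.find_min hex hli ⟨hl, h⟩

lemma exists_dist_lt_of_homeomorph (h : ℂ ≃ₜ ℂ) {p y : ℂ} {r : ℝ} (hr : 0 < r) (hy : dist y p = r)
    (hhy : dist (h y) p < r) : ∃ x, dist x p < r ∧ dist (h x) p < r := by
  have hc : Tendsto (fun t : ℝ ↦ dist (h (p + (1 - t) • (y - p))) p) (𝓝[>] 0)
      (𝓝 (dist (h y) p)) := by
    have : Continuous fun t : ℝ ↦ dist (h (p + (1 - t) • (y - p))) p := by fun_prop
    have := this.tendsto 0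
    simp only [sub_zero, one_smul, add_sub_cancel] at this
    exact this.mono_left nhdsWithin_le_nhds
  obtain ⟨t, ht, ht0, ht1⟩ := ((hc.eventually_lt_const hhy).and
    (Ioo_mem_nhdsGT (zero_lt_one' ℝ))).exists
  refine ⟨_, ?_, ht⟩
  rw [dist_eq_norm, add_sub_cancel_left, norm_smul, ← dist_eq_norm y, hy, Real.norm_eq_abs,
    abs_of_pos (by linarith)]
  nlinarith

lemma eq_of_internally_tangent {p q x : ℂ} {r : ℝ} (hq : dist q p = r) (hx : dist x p = r)
    (h : dist x (p + (q - p) / 4) ≤ 3 * r / 4) : x = q := by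
  have h0 : 0 ≤ r := hq ▸ dist_nonneg
  rw [Complex.dist_eq_re_im] at hq hx h
  have e1 := Real.sqrt_eq_iff_mul_self_eq (by positivity) h0 |>.1 hq
  have e2 := Real.sqrt_eq_iff_mul_self_eq (by positivity) h0 |>.1 hx
  have e3 := (Real.sqrt_le_left (by positivity)).1 h
  have r4 : ((q - p) / 4).re = (q.re - p.re) / 4 := by
    simp
  have i4 : ((q - p) / 4).im = (q.im - p.im) / 4 := by
    simp
  rw [Complex.add_re, Complex.add_im, r4, i4] at e3
  have h1 : (x.re - q.re) ^ 2 + (x.im - q.im) ^ 2 ≤ 0 := by nlinarith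
  have h2 : x.re - q.re = 0 := by nlinarith [sq_nonneg (x.re - q.re), sq_nonneg (x.im - q.im)]
  have h3 : x.im - q.im = 0 := by nlinarith [sq_nonneg (x.re - q.re), sq_nonneg (x.im - q.im)]
  exact Complex.ext (sub_eq_zero.1 h2) (sub_eq_zero.1 h3)

/-- A largest free disc centred at `p` touches its image. -/
lemma IsBrouwerC.exists_tangent_disc {f : ℂ ≃ₜ ℂ} (hf : IsBrouwerC f) (p : ℂ) :
    ∃ r > 0, ∃ y, dist y p = r ∧ dist (f y) p = r ∧
      ∀ z ∈ Metric.ball p r, f z ∉ Metric.ball p r := by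
  have hm : Continuous fun x ↦ max (dist x p) (dist (f x) p) := by fun_prop
  obtain ⟨y, hy⟩ := hm.exists_forall_le
    (tendsto_atTop_mono (fun x ↦ le_max_left _ _) (tendsto_dist_right_cocompact_atTop p))
  set r := max (dist y p) (dist (f y) p) with hr
  have h1 : dist y p ≤ r := le_max_left _ _
  have h2 : dist (f y) p ≤ r := le_max_right _ _
  have hno : ∀ x, dist x p < r → dist (f x) p < r → False := fun x hx hfx ↦
    (hy x).not_gt (max_lt hx hfx)
  have hr0 : 0 < r := by
    by_contra! h
    have e1 : y = p := dist_le_zero.1 (h1.trans h)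
    have e2 : f y = p := dist_le_zero.1 (h2.trans h)
    exact hf.1 y (e2.trans e1.symm)
  refine ⟨r, hr0, y, ?_, ?_, fun z hz hfz ↦ hno z hz hfz⟩
  · by_contra hne
    have hlt := lt_of_le_of_ne h1 hne
    have heq : dist (f y) p = r := by
      rcases max_choice (dist y p) (dist (f y) p) with h | h
      · exact absurd h.symm hne
      · exact h.symm
    obtain ⟨x, hx, hx'⟩ := exists_dist_lt_of_homeomorph f.symm hr0 heq (by simpa using hlt)
    exact hno _ hx' (by simpa using hx)
  · by_contra hne
    have hlt := lt_of_le_of_ne h2 hne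
    have heq : dist y p = r := by
      rcases max_choice (dist y p) (dist (f y) p) with h | h
      · exact h.symm
      · exact absurd h.symm hne
    obtain ⟨x, hx, hx'⟩ := exists_dist_lt_of_homeomorph f hr0 heq hlt
    exact hno _ hx hx'

lemma tangent_ball_subset {p q : ℂ} {r : ℝ} (hq : dist q p = r) :
    Metric.ball (p + (q - p) / 4) (3 * r / 4) ⊆ Metric.ball p r := by
  refine Metric.ball_subset_ball' ?_
  rw [dist_eq_norm, add_sub_cancel_left, norm_div, ← dist_eq_norm, hq]
  norm_num
  linarith

lemma center_mem_tangent_ball {p q : ℂ} {r : ℝ} (hr : 0 < r) (hq : dist q p = r) :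
    p ∈ Metric.ball (p + (q - p) / 4) (3 * r / 4) := by
  rw [Metric.mem_ball, dist_comm, dist_eq_norm, add_sub_cancel_left, norm_div, ← dist_eq_norm, hq]
  norm_num
  linarith

lemma mem_closure_tangent_ball {p q : ℂ} {r : ℝ} (hr : 0 < r) (hq : dist q p = r) :
    q ∈ closure (Metric.ball (p + (q - p) / 4) (3 * r / 4)) := by
  rw [closure_ball _ (by positivity), Metric.mem_closedBall, dist_eq_norm]
  have : q - (p + (q - p) / 4) = 3 / 4 * (q - p) := by ring
  rw [this, norm_mul, ← dist_eq_norm, hq]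
  norm_num
  linarith

theorem IsBrouwerC.iterate_ne {f : ℂ ≃ₜ ℂ} (hf : IsBrouwerC f) {k : ℕ} (hk : 0 < k) (p : ℂ) :
    f^[k] p ≠ p := by
  induction k using Nat.strong_induction_on generalizing f p with
  | _ k ih =>
  intro hp
  obtain rfl | rfl | hk3 : k = 1 ∨ k = 2 ∨ 3 ≤ k := by omega
  · exact hf.1 p hp
  · obtain ⟨z, hz⟩ := exists_fixedPoint_of_swap f hf.2 (hf.1 p).symm rfl hp
    exact hf.1 z hz
  have hW : ∀ D : Set ℂ, IsOpen D → IsPreconnected D → (∀ z ∈ D, f z ∉ D) → ∀ z ∈ D, ∀ j, 0 < j →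
      j < k → f^[j] z ∉ D := by
    intro D hDo hDc hD z hz j hj hjk hr
    obtain ⟨f', hf', i, p', hi, hij, hp'⟩ := hf.exists_periodic_of_return hDo hDc hD hz hj hr
    exact ih i (by omega) hf' hi p' hp'
  obtain ⟨r, hr, y, hy, hq, hfree⟩ := hf.exists_tangent_disc p
  have hpc : ∀ (c : ℂ) (s : ℝ), IsPreconnected (Metric.ball c s) := fun c s ↦
    (convex_ball c s).isPreconnected
  have hfD : ∀ z ∈ Metric.ball p r, ∀ j, 0 < j → j < k → f^[j] z ∉ Metric.ball p r :=
    hW _ Metric.isOpen_ball (hpc _ _) hfree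
  have hdis : Disjoint (f ⁻¹' Metric.ball p r) (Metric.ball p r) :=
    Set.disjoint_left.2 fun z hz hz' ↦ hfree z hz' hz
  have hcl : closure (Metric.ball p r) = Metric.closedBall p r := closure_ball p hr.ne'
  have hD1 : ∀ z ∈ Metric.closedBall p r, f z ∉ Metric.ball p r := by
    have := hdis.closure_right (Metric.isOpen_ball.preimage f.continuous)
    rw [hcl] at this
    exact fun z hz hz' ↦ Set.disjoint_left.1 this hz' hz
  have hD2 : ∀ z ∈ Metric.ball p r, f z ∉ Metric.closedBall p r := by
    have := hdis.closure_left Metric.isOpen_ball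
    rw [← f.preimage_closure, hcl] at this
    exact fun z hz hz' ↦ Set.disjoint_left.1 this hz' hz
  have hsub : ∀ c, dist c p = r → closure (Metric.ball (p + (c - p) / 4) (3 * r / 4)) ⊆
      Metric.closedBall p r := fun c hc ↦ hcl ▸ closure_mono (tangent_ball_subset hc)
  have htan : ∀ c, dist c p = r → ∀ x ∈ closure (Metric.ball (p + (c - p) / 4) (3 * r / 4)),
      x ∉ Metric.ball p r → x = c := by
    intro c hc x hx hxn
    have h1 : dist x p = r := le_antisymm (hsub c hc hx) (not_lt.1 hxn)
    rw [closure_ball _ (by positivity)] at hx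
    exact eq_of_internally_tangent hc h1 hx
  set q := f y with hqdef
  set D₁ := Metric.ball (p + (q - p) / 4) (3 * r / 4) with hD₁
  set D₂ := Metric.ball (p + (y - p) / 4) (3 * r / 4) with hD₂
  have hD₁D : D₁ ⊆ Metric.ball p r := tangent_ball_subset hq
  have hD₂D : D₂ ⊆ Metric.ball p r := tangent_ball_subset hy
  have hfq : f q ∉ closure D₁ := fun h ↦
    hf.1 q (htan q hq _ h (hD1 q (Metric.mem_closedBall.2 hq.le)))
  have hfq2 : f.symm (f.symm q) ∉ closure D₂ := by
    intro h
    rw [hqdef, f.symm_apply_apply] at h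
    refine hf.1 y ?_
    have h1 := htan y hy _ h fun h' ↦ hD2 _ h' (by
      rw [f.apply_symm_apply]; exact Metric.mem_closedBall.2 hy.le)
    exact (f.symm_apply_eq.1 h1).symm
  obtain ⟨A, B, hA, hB, hqA, hqB, hAB⟩ := t2_separation (hf.1 q).symm
  have hN : (A ∩ f ⁻¹' B) ∩ (f ⁻¹' (closure D₁)ᶜ ∩ (fun z ↦ f.symm (f.symm z)) ⁻¹' (closure D₂)ᶜ)
      ∈ 𝓝 q := by
    refine IsOpen.mem_nhds ?_ ⟨⟨hqA, hqB⟩, hfq, hfq2⟩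
    exact (hA.inter (hB.preimage f.continuous)).inter
      ((isClosed_closure.isOpen_compl.preimage f.continuous).inter
        (isClosed_closure.isOpen_compl.preimage (by fun_prop)))
  obtain ⟨δ, hδ, hWN⟩ := Metric.mem_nhds_iff.1 hN
  set W := Metric.ball q δ with hWdef
  set s : Set ℂ := (fun j ↦ f^[j] p) '' Ico 2 k with hs
  have hsfin : s.Finite := (finite_Ico 2 k).image _
  have hO : IsOpen (W \ s) := Metric.isOpen_ball.sdiff hsfin.isClosed
  have hpD := center_mem_tangent_ball hr hq
  have hpD' := center_mem_tangent_ball hr hy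
  have hpB : p ∈ Metric.ball p r := Metric.mem_ball_self hr
  obtain ⟨a, haW, haD⟩ := mem_closure_iff_nhds.1 (mem_closure_tangent_ball hr hq) W
    (Metric.ball_mem_nhds q hδ)
  obtain ⟨b, hbW, hbD⟩ := mem_closure_iff_nhds.1 (mem_closure_tangent_ball hr hy) (f ⁻¹' W)
    (f.continuous.continuousAt.preimage_mem_nhds (Metric.ball_mem_nhds q hδ))
  have hitD : ∀ j, 2 ≤ j → j < k → ∀ x ∈ D₂, f x ≠ f^[j] p := by
    intro j hj hjk x hx hxj
    obtain ⟨i, rfl⟩ : ∃ i, j = i + 1 := ⟨j - 1, by omega⟩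
    rw [Function.iterate_succ_apply', f.injective.eq_iff] at hxj
    exact hfD p hpB i (by omega) (by omega) (hxj ▸ hD₂D hx)
  have haO : a ∈ W \ s := by
    refine ⟨haW, ?_⟩
    rintro ⟨j, hj, rfl⟩
    exact hfD p hpB j (by have := hj.1; omega) hj.2 (hD₁D haD)
  have hbO : f b ∈ W \ s := by
    refine ⟨hbW, ?_⟩
    rintro ⟨j, hj, hjb⟩
    exact hitD j hj.1 hj.2 b hbD hjb.symm
  obtain ⟨g₁, hg₁, hg₁D, hg₁p⟩ := (hpc _ _).movesIn Metric.isOpen_ball hpD haD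
  obtain ⟨g₂, hg₂, hg₂O, hg₂a⟩ :=
    (isPreconnected_ball_diff_finite q δ hsfin).movesIn hO haO hbO
  obtain ⟨g₃, hg₃, hg₃D, hg₃b⟩ :=
    ((hpc (p + (y - p) / 4) (3 * r / 4)).image f f.continuous.continuousOn).movesIn
      (f.isOpenMap _ Metric.isOpen_ball) (mem_image_of_mem f hbD) (mem_image_of_mem f hpD')
  have hbr : IsBrouwerC (f.trans (g₁.trans (g₂.trans g₃))) := by
    refine ⟨fun z hz ↦ ?_, ((hg₃.comp hg₂).comp hg₁).comp hf.2⟩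
    change g₃ (g₂ (g₁ (f z))) = z at hz
    have h2 : ∀ x, x ∈ W \ s → x ∈ W := fun x hx ↦ hx.1
    rcases eq_or_mem_of_support hg₁D (f z) with e1 | ⟨e1, e1'⟩ <;>
    rcases eq_or_mem_of_support hg₂O (g₁ (f z)) with e2 | ⟨e2, e2'⟩ <;>
    rcases eq_or_mem_of_support hg₃D (g₂ (g₁ (f z))) with e3 | ⟨e3, e3'⟩
    · rw [e3, e2, e1] at hz
      exact hf.1 z hz
    · rw [e2, e1] at e3
      rw [hz] at e3'
      obtain ⟨x, hx, rfl⟩ := e3'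
      obtain ⟨x', hx', h⟩ := e3
      rw [f.injective h] at hx'
      exact hfree x (hD₂D hx) (hD₂D hx')
    · rw [e3] at hz
      rw [e1] at e2
      rw [hz] at e2'
      exact Set.disjoint_left.1 hAB (hWN e2.1).1.1 (hWN e2'.1).1.2
    · rw [e1] at e2
      rw [hz] at e3'
      obtain ⟨x, hx, rfl⟩ := e3'
      have := (hWN e2.1).2.2
      simp only [mem_preimage, f.symm_apply_apply] at this
      exact this (subset_closure hx)
    · rw [e3, e2] at hz
      rw [hz] at e1'
      exact hfree z (hD₁D e1') (hD₁D e1)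
    · rw [hz] at e3'
      obtain ⟨x, hx, rfl⟩ := e3'
      exact hfD x (hD₂D hx) 2 (by omega) (by omega) (hD₁D e1)
    · rw [e3] at hz
      rw [hz] at e2'
      exact (hWN e2'.1).2.1 (subset_closure e1)
    · rw [hz] at e3'
      obtain ⟨x, hx, rfl⟩ := e3'
      exact hfD x (hD₂D hx) 2 (by omega) (by omega) (hD₁D e1)
  refine ih (k - 1) (by omega) hbr (by omega) (f p) ?_
  change (g₃ ∘ g₂ ∘ g₁ ∘ f)^[_] (f p) = f p
  rw [← Function.comp_assoc, ← Function.comp_assoc, iterate_comp_of_fixed (by omega),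
    ← Function.iterate_succ_apply,
    Nat.succ_eq_add_one, Nat.sub_add_cancel hk, hp]
  · change g₃ (g₂ (g₁ p)) = f p
    rw [hg₁p, hg₂a, hg₃b]
  · intro i hi hik
    rw [← Function.iterate_succ_apply, Nat.succ_eq_add_one]
    change g₃ (g₂ (g₁ _)) = _
    rw [hg₁D _ fun h ↦ hfD p hpB (i + 1) (by omega) (by omega) (hD₁D h),
      hg₂O _ fun h ↦ h.2 ⟨i + 1, ⟨by omega, by omega⟩, rfl⟩, hg₃D]
    rintro ⟨x, hx, hxi⟩
    exact hitD (i + 1) (by omega) (by omega) x hx hxi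

/-! ### Free disc chains of length two -/

lemma IsBrouwerC.iterate_notMem {f : ℂ ≃ₜ ℂ} (hf : IsBrouwerC f) {D : Set ℂ}
    (hDo : IsOpen D) (hDc : IsPreconnected D) (hD : ∀ z ∈ D, f z ∉ D) {z : ℂ} (hz : z ∈ D) {j : ℕ}
    (hj : 0 < j) : f^[j] z ∉ D := by
  intro hr
  obtain ⟨f', hf', i, p, hi, -, hp⟩ := hf.exists_periodic_of_return hDo hDc hD hz hj hr
  exact hf'.iterate_ne hi p hp

/-- Franks' lemma for a cycle of two free discs. -/
theorem IsBrouwerC.false_of_cycle {f : ℂ ≃ₜ ℂ} (hf : IsBrouwerC f) {D E : Set ℂ}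
    (hDo : IsOpen D) (hDc : IsPreconnected D) (hD : ∀ z ∈ D, f z ∉ D)
    (hEo : IsOpen E) (hEc : IsPreconnected E) (hE : ∀ z ∈ E, f z ∉ E) (hDE : Disjoint D E)
    {x y : ℂ} (hx : x ∈ D) (hy : y ∈ E) (hxE : ∃ j, 0 < j ∧ f^[j] x ∈ E)
    (hyD : ∃ i, 0 < i ∧ f^[i] y ∈ D) : False := by
  classical
  set j := Nat.find hxE with hj
  set i := Nat.find hyD with hi
  obtain ⟨hj0, hjE⟩ : 0 < j ∧ f^[j] x ∈ E := Nat.find_spec hxE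
  obtain ⟨hi0, hiD⟩ : 0 < i ∧ f^[i] y ∈ D := Nat.find_spec hyD
  have hDE' := Set.disjoint_left.1 hDE
  obtain ⟨g, hg, hgD, hgy⟩ := hDc.movesIn hDo hiD hx
  obtain ⟨h, hh, hhE, hhx⟩ := hEc.movesIn hEo hjE hy
  have hbr : IsBrouwerC (f.trans (h.trans g)) := by
    refine ⟨fun z hz ↦ ?_, (hg.comp hh).comp hf.2⟩
    change g (h (f z)) = z at hz
    rcases eq_or_mem_of_support hhE (f z) with e1 | ⟨e1, e1'⟩ <;>
    rcases eq_or_mem_of_support hgD (h (f z)) with e2 | ⟨e2, e2'⟩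
    · rw [e2, e1] at hz
      exact hf.1 z hz
    · rw [hz] at e2'
      rw [e1] at e2
      exact hD z e2' e2
    · rw [← e2, hz] at e1'
      exact hE z e1' e1
    · exact hDE' e2 e1'
  refine hbr.iterate_ne (k := i + j) (by omega) x ?_
  change ((g ∘ h) ∘ f)^[i + j] x = x
  rw [Function.iterate_add_apply, iterate_comp_of_fixed hj0, Function.comp_apply, hhx,
    hgD y fun h ↦ hDE' h hy, iterate_comp_of_fixed hi0, Function.comp_apply,
    hhE _ fun h ↦ hDE' hiD h, hgy]
  · intro l hl hli
    rw [Function.comp_apply, hhE _ (hf.iterate_notMem hEo hEc hE hy hl),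
      hgD _ fun h ↦ Nat.find_min hyD hli ⟨hl, h⟩]
  · intro l hl hlj
    rw [Function.comp_apply, hhE _ fun h ↦ Nat.find_min hxE hlj ⟨hl, h⟩,
      hgD _ (hf.iterate_notMem hDo hDc hD hx hl)]

lemma isOpenMap_iterate {X : Type*} [TopologicalSpace X] (f : X ≃ₜ X) (k : ℕ) :
    IsOpenMap f^[k] := by
  induction k with
  | zero => exact IsOpenMap.id
  | succ k ih => exact ih.comp f.isOpenMap

/-- The set of transition times between two free discs is an interval. -/
theorem IsBrouwerC.exists_transition {f : ℂ ≃ₜ ℂ} (hf : IsBrouwerC f) {U V : Set ℂ}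
    (hUo : IsOpen U) (hUc : IsPreconnected U) (hU : ∀ z ∈ U, f z ∉ U)
    (hVo : IsOpen V) (hVc : IsPreconnected V) (hV : ∀ z ∈ V, f z ∉ V) {n k m : ℕ} (hnk : n < k)
    (hkm : k < m) (hn : ∃ u ∈ U, f^[n] u ∈ V) (hm : ∃ u ∈ U, f^[m] u ∈ V) :
    ∃ u ∈ U, f^[k] u ∈ V := by
  by_contra! hk
  obtain ⟨u, hu, hun⟩ := hn
  obtain ⟨w, hw, hwm⟩ := hm
  refine hf.false_of_cycle (D := f^[k] '' U) (E := V) (isOpenMap_iterate f k U hUo)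
    (hUc.image _ (f.continuous.iterate k).continuousOn) ?_ hVo hVc hV ?_
    (mem_image_of_mem _ hw) hun ⟨m - k, by omega, ?_⟩ ⟨k - n, by omega, ?_⟩
  · rintro _ ⟨z, hz, rfl⟩ ⟨z', hz', h⟩
    rw [← Function.iterate_succ_apply' f, Function.iterate_succ_apply] at h
    exact hU z hz (f.injective.iterate k h ▸ hz')
  · rw [Set.disjoint_left]
    rintro _ ⟨z, hz, rfl⟩
    exact hk z hz
  · rwa [← Function.iterate_add_apply, Nat.sub_add_cancel hkm.le]
  · rw [← Function.iterate_add_apply, Nat.sub_add_cancel hnk.le]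
    exact mem_image_of_mem _ hu

/-! ### Transfer to `ℝ × ℝ` -/

/-- The conjugate of a homeomorphism of `ℝ × ℝ` by the identification with `ℂ`. -/
noncomputable def conjHomeo (f : (ℝ × ℝ) ≃ₜ (ℝ × ℝ)) : ℂ ≃ₜ ℂ :=
  (Complex.equivRealProdCLM.toHomeomorph.trans f).trans Complex.equivRealProdCLM.symm.toHomeomorph

lemma conjHomeo_iterate (f : (ℝ × ℝ) ≃ₜ (ℝ × ℝ)) (n : ℕ) (z : ℂ) :
    Complex.equivRealProdCLM ((conjHomeo f)^[n] z) = f^[n] (Complex.equivRealProdCLM z) := by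
  have : Function.Semiconj Complex.equivRealProdCLM (conjHomeo f) f := fun z ↦ by
    change Complex.equivRealProdCLM (Complex.equivRealProdCLM.symm _) = _
    rw [ContinuousLinearEquiv.apply_symm_apply]
    rfl
  exact this.iterate_right n z

lemma IsBrouwer.isBrouwerC {f : (ℝ × ℝ) ≃ₜ (ℝ × ℝ)} (hf : IsBrouwer f) :
    IsBrouwerC (conjHomeo f) := by
  obtain ⟨hf1, H, hHc, hH, hH0, hH1⟩ := hf
  refine ⟨fun z hz ↦ hf1 (Complex.equivRealProdCLM z) ?_,
    fun t z ↦ Complex.equivRealProdCLM.symm (H t (Complex.equivRealProdCLM z)), ?_, ?_, ?_, ?_⟩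
  · have := conjHomeo_iterate f 1 z
    rw [Function.iterate_one, hz] at this
    exact this.symm
  · exact Complex.equivRealProdCLM.symm.continuous.comp
      (hHc.comp (continuous_fst.prodMk (Complex.equivRealProdCLM.continuous.comp continuous_snd)))
  · intro t ht
    obtain ⟨g, hg⟩ := hH t ht
    simp only [← hg]
    exact Complex.equivRealProdCLM.symm.injective.comp
      (g.injective.comp Complex.equivRealProdCLM.injective)
  · funext z
    simp only [hH0, id]
    exact ContinuousLinearEquiv.symm_apply_apply _ _
  · funext z
    simp only [hH1]
    rfl

section Plane

variable {f : (ℝ × ℝ) ≃ₜ (ℝ × ℝ)}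

lemma free_preimage {U : Set (ℝ × ℝ)} (hU : ∀ z ∈ U, f z ∉ U) :
    ∀ z ∈ Complex.equivRealProdCLM ⁻¹' U, conjHomeo f z ∉ Complex.equivRealProdCLM ⁻¹' U := by
  intro z hz hz'
  rw [mem_preimage] at hz hz'
  rw [← Function.iterate_one (conjHomeo f), conjHomeo_iterate] at hz'
  exact hU _ hz hz'

lemma isPreconnected_preimage {U : Set (ℝ × ℝ)} (hU : IsPreconnected U) :
    IsPreconnected (Complex.equivRealProdCLM ⁻¹' U) := by
  have := Complex.equivRealProdCLM.toHomeomorph.isPreconnected_preimage.2 hU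
  exact this

lemma IsBrouwer.iterate_notMem (hf : IsBrouwer f) {D : Set (ℝ × ℝ)}
    (hDo : IsOpen D) (hDc : IsPreconnected D) (hD : ∀ z ∈ D, f z ∉ D) {z : ℝ × ℝ} (hz : z ∈ D)
    {j : ℕ} (hj : 0 < j) : f^[j] z ∉ D := by
  have := hf.isBrouwerC.iterate_notMem (hDo.preimage Complex.equivRealProdCLM.continuous)
    (isPreconnected_preimage hDc) (free_preimage hD) (z := Complex.equivRealProdCLM.symm z)
    (by simpa using hz) hj
  rwa [mem_preimage, conjHomeo_iterate, ContinuousLinearEquiv.apply_symm_apply] at this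

theorem IsBrouwer.exists_transition (hf : IsBrouwer f) {U V : Set (ℝ × ℝ)}
    (hUo : IsOpen U) (hUc : IsPreconnected U) (hU : ∀ z ∈ U, f z ∉ U)
    (hVo : IsOpen V) (hVc : IsPreconnected V) (hV : ∀ z ∈ V, f z ∉ V) {n k m : ℕ} (hnk : n < k)
    (hkm : k < m) (hn : ∃ u ∈ U, f^[n] u ∈ V) (hm : ∃ u ∈ U, f^[m] u ∈ V) :
    ∃ u ∈ U, f^[k] u ∈ V := by
  have key : ∀ n, (∃ u ∈ Complex.equivRealProdCLM ⁻¹' U,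
      (conjHomeo f)^[n] u ∈ Complex.equivRealProdCLM ⁻¹' V) ↔ ∃ u ∈ U, f^[n] u ∈ V := by
    intro n
    simp only [mem_preimage, conjHomeo_iterate]
    exact (Complex.equivRealProdCLM.surjective.exists
      (p := fun u ↦ u ∈ U ∧ f^[n] u ∈ V)).symm
  rw [← key] at hn hm ⊢
  exact hf.isBrouwerC.exists_transition (hUo.preimage Complex.equivRealProdCLM.continuous)
    (isPreconnected_preimage hUc) (free_preimage hU)
    (hVo.preimage Complex.equivRealProdCLM.continuous)
    (isPreconnected_preimage hVc) (free_preimage hV) hnk hkm hn hm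

end Plane

/-! ### Separated sets -/

section Separated

variable {X : Type*} [MetricSpace X] {f : X → X} {n : ℕ} {ε : ℝ}

lemma IsDynSeparated.card_le {T : Type*} [Fintype T] (c : X → T)
    (hc : ∀ x y, c x = c y → ∀ k < n, dist (f^[k] x) (f^[k] y) ≤ ε) {E : Finset X}
    (hE : IsDynSeparated f n ε ↑E) : E.card ≤ Fintype.card T := by
  refine Finset.card_le_card_of_injOn c (fun _ _ ↦ Finset.mem_univ _) fun x hx y hy hxy ↦ ?_
  by_contra hne
  obtain ⟨k, hk, hlt⟩ := hE x hx y hy hne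
  exact (hc x y hxy k hk).not_gt hlt

lemma maxSep_le_card {T : Type*} [Fintype T] (c : X → T)
    (hc : ∀ x y, c x = c y → ∀ k < n, dist (f^[k] x) (f^[k] y) ≤ ε) :
    maxSep f n ε ≤ Fintype.card T := by
  refine csSup_le ⟨0, ∅, fun x hx ↦ by simp at hx, rfl⟩ ?_
  rintro _ ⟨E, hE, rfl⟩
  exact hE.card_le c hc

lemma IsDynSeparated.card_le_maxSep {T : Type*} [Fintype T] (c : X → T)
    (hc : ∀ x y, c x = c y → dist x y ≤ ε) {E : Finset X} (hE : IsDynSeparated f n ε ↑E) :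
    E.card ≤ maxSep f n ε := by
  refine le_csSup ⟨Fintype.card (Fin n → T), ?_⟩ ⟨E, hE, rfl⟩
  rintro _ ⟨E', hE', rfl⟩
  exact hE'.card_le (fun x (k : Fin n) ↦ c (f^[k] x)) fun x y hxy k hk ↦
    hc _ _ (congrFun hxy ⟨k, hk⟩)

lemma tendsto_div_log (a : ℝ) : Tendsto (fun n : ℕ ↦ a / Real.log n) atTop (𝓝 0) :=
  tendsto_const_nhds.div_atTop (Real.tendsto_log_atTop.comp tendsto_natCast_atTop_atTop)

lemma polEntropy_le_one (h : ∀ ε > 0, ∃ C : ℕ, ∀ n, maxSep f n ε ≤ C * (n + 1)) :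
    polEntropy f ≤ 1 := by
  refine iSup₂_le fun ε hε ↦ ?_
  obtain ⟨C, hC⟩ := h ε hε
  have ht : Tendsto (fun n : ℕ ↦ ENNReal.ofReal (Real.log (2 * (C + 1)) / Real.log n + 1)) atTop
      (𝓝 1) := by
    have := ENNReal.tendsto_ofReal ((tendsto_div_log (Real.log (2 * (C + 1)))).add_const 1)
    simpa using this
  rw [← ht.limsup_eq]
  refine limsup_le_limsup ?_
  filter_upwards [eventually_ge_atTop 2] with n hn
  have hn' : (2 : ℝ) ≤ n := by exact_mod_cast hn
  have hlog : 0 < Real.log n := Real.log_pos (by linarith)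
  apply ENNReal.ofReal_le_ofReal
  rw [div_add_one hlog.ne']
  gcongr
  rw [← Real.log_mul (by positivity) (by positivity)]
  have hle : (maxSep f n ε : ℝ) ≤ 2 * (C + 1) * n := by
    have : (maxSep f n ε : ℝ) ≤ C * (n + 1) := by exact_mod_cast hC n
    nlinarith [(Nat.cast_nonneg C : (0 : ℝ) ≤ C)]
  rcases Nat.eq_zero_or_pos (maxSep f n ε) with h0 | h0
  · rw [h0, Nat.cast_zero, Real.log_zero]
    refine Real.log_nonneg ?_
    nlinarith [(Nat.cast_nonneg C : (0 : ℝ) ≤ C)]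
  · exact Real.log_le_log (by exact_mod_cast h0) hle

lemma two_le_polEntropy (hε : 0 < ε) {n₀ : ℕ} (h : ∀ n ≥ n₀, n ^ 2 ≤ 16 * maxSep f n ε) :
    2 ≤ polEntropy f := by
  refine le_trans ?_ (le_iSup₂ (f := fun (ε : ℝ) (_ : 0 < ε) ↦
    Filter.atTop.limsup fun n : ℕ =>
      ENNReal.ofReal (Real.log (maxSep f n ε) / Real.log n)) ε hε)
  have ht : Tendsto (fun n : ℕ ↦ ENNReal.ofReal (2 - Real.log 16 / Real.log n)) atTop
      (𝓝 2) := by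
    have := ENNReal.tendsto_ofReal ((tendsto_div_log (Real.log 16)).const_sub 2)
    simpa using this
  rw [← ht.limsup_eq]
  refine limsup_le_limsup ?_
  filter_upwards [eventually_ge_atTop 2, eventually_ge_atTop n₀] with n hn hn₀
  have hn' : (2 : ℝ) ≤ n := by exact_mod_cast hn
  have hlog : 0 < Real.log n := Real.log_pos (by linarith)
  apply ENNReal.ofReal_le_ofReal
  rw [← sub_nonneg]
  have : Real.log (maxSep f n ε) / Real.log n - (2 - Real.log 16 / Real.log n) =
      (Real.log 16 + Real.log (maxSep f n ε) - 2 * Real.log n) / Real.log n := by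
    field_simp
    ring
  rw [this]
  refine div_nonneg (sub_nonneg.2 ?_) hlog.le
  have hle : (n : ℝ) ^ 2 ≤ 16 * maxSep f n ε := by exact_mod_cast h n hn₀
  have hpos : (0 : ℝ) < maxSep f n ε := by nlinarith
  rw [← Real.log_mul (by norm_num) hpos.ne']
  have := Real.log_le_log (by positivity) hle
  rwa [Real.log_pow, Nat.cast_ofNat] at this

end Separated

/-! ### The metric on the sphere -/

lemma dist_onePoint (z w : OnePoint (ℝ × ℝ)) : dist z w = dist (spherePoint z) (spherePoint w) :=
  rfl

lemma spherePoint_coe (w : ℝ × ℝ) :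
    spherePoint w = ((1 + ‖w‖ ^ 2)⁻¹ • w, (1 + ‖w‖ ^ 2)⁻¹) := rfl

lemma spherePoint_infty : spherePoint OnePoint.infty = 0 := rfl

lemma norm_spherePoint_coe (w : ℝ × ℝ) :
    ‖spherePoint w‖ = max ((1 + ‖w‖ ^ 2)⁻¹ * ‖w‖) (1 + ‖w‖ ^ 2)⁻¹ := by
  have : 0 ≤ (1 + ‖w‖ ^ 2)⁻¹ := by positivity
  rw [spherePoint_coe, Prod.norm_mk, norm_smul, Real.norm_of_nonneg this]

lemma norm_spherePoint_le (z : OnePoint (ℝ × ℝ)) : ‖spherePoint z‖ ≤ 1 := by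
  induction z using OnePoint.rec with
  | infty => simp [spherePoint_infty]
  | coe w =>
    rw [norm_spherePoint_coe]
    refine max_le ?_ (inv_le_one_of_one_le₀ (by nlinarith [sq_nonneg ‖w‖]))
    rw [inv_mul_le_iff₀ (by positivity)]
    nlinarith [sq_nonneg (‖w‖ - 1)]

lemma norm_spherePoint_lt {ε : ℝ} (hε : 0 < ε) {w : ℝ × ℝ} (hw : max 1 (1 / ε) ≤ ‖w‖) :
    ‖spherePoint w‖ < ε := by
  have h1 : 1 ≤ ‖w‖ := (le_max_left _ _).trans hw
  have h2 : 1 / ε ≤ ‖w‖ := (le_max_right _ _).trans hw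
  rw [div_le_iff₀ hε] at h2
  rw [norm_spherePoint_coe]
  refine max_lt ?_ ?_
  · rw [inv_mul_lt_iff₀ (by positivity)]
    nlinarith
  · rw [inv_lt_iff_one_lt_mul₀ (by positivity)]
    nlinarith

lemma exists_finite_classification {ε : ℝ} (hε : 0 < ε) :
    ∃ (N : ℕ) (c : OnePoint (ℝ × ℝ) → Fin N), ∀ x y, c x = c y → dist x y ≤ ε := by
  have htb : TotallyBounded (Metric.closedBall (0 : (ℝ × ℝ) × ℝ) 1) :=
    (isCompact_closedBall _ _).totallyBounded
  obtain ⟨t, ht, hcov⟩ := Metric.totallyBounded_iff.1 htb (ε / 2) (by positivity)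
  have hex : ∀ x : OnePoint (ℝ × ℝ), ∃ p : t, dist (spherePoint x) p < ε / 2 := by
    intro x
    have := hcov (mem_closedBall_zero_iff.2 (norm_spherePoint_le x))
    simpa using this
  choose p hp using hex
  have := ht.fintype
  refine ⟨Fintype.card t, fun x ↦ Fintype.equivFin t (p x), fun x y hxy ↦ ?_⟩
  have hpxy : p x = p y := (Fintype.equivFin t).injective hxy
  rw [dist_onePoint]
  have h1 := hp x
  have h2 := hp y
  rw [← hpxy, dist_comm] at h2
  linarith [dist_triangle (spherePoint x) (p x) (spherePoint y)]

lemma exists_sphere_separation (x : ℝ × ℝ) {r : ℝ} (hr : 0 < r) :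
    ∃ ρ > 0, ∃ ε > 0, ∀ u ∈ Metric.ball x ρ, ∀ w : ℝ × ℝ,
      dist (u : OnePoint (ℝ × ℝ)) w ≤ ε → w ∈ Metric.ball x r := by
  have hpos : ∀ w : ℝ × ℝ, (1 + ‖w‖ ^ 2)⁻¹ ≠ 0 := fun w ↦ by positivity
  have hinv : ∀ w : ℝ × ℝ, (spherePoint w).2⁻¹ • (spherePoint w).1 = w := fun w ↦ by
    rw [spherePoint_coe, smul_smul, inv_mul_cancel₀ (hpos w), one_smul]
  have hc : ContinuousAt (fun q : (ℝ × ℝ) × ℝ ↦ q.2⁻¹ • q.1) (spherePoint x) :=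
    (continuousAt_snd.inv₀ (hpos x)).smul continuousAt_fst
  obtain ⟨δ, hδ, hδr⟩ := Metric.continuousAt_iff.1 hc r hr
  have hs : Continuous fun w : ℝ × ℝ ↦ spherePoint w := by
    simp only [spherePoint_coe]
    have : Continuous fun w : ℝ × ℝ ↦ (1 + ‖w‖ ^ 2)⁻¹ :=
      (by fun_prop : Continuous fun w : ℝ × ℝ ↦ 1 + ‖w‖ ^ 2).inv₀ fun w ↦ by positivity
    fun_prop
  obtain ⟨ρ, hρ, hρδ⟩ := Metric.continuous_iff.1 hs x (δ / 3) (by positivity)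
  refine ⟨ρ, hρ, δ / 3, by positivity, fun u hu w hw ↦ ?_⟩
  have h1 := hρδ u hu
  rw [dist_onePoint, dist_comm] at hw
  have h2 := hδr (x := spherePoint w) (by
    linarith [dist_triangle (spherePoint w) (spherePoint u) (spherePoint x)])
  rwa [hinv, hinv] at h2

lemma onePointExtend_iterate_coe (g : ℝ × ℝ → ℝ × ℝ) (n : ℕ) (w : ℝ × ℝ) :
    (onePointExtend g)^[n] (w : OnePoint (ℝ × ℝ)) = ((g^[n] w : ℝ × ℝ) : OnePoint (ℝ × ℝ)) := by
  induction n generalizing w with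
  | zero => rfl
  | succ n ih =>
    rw [Function.iterate_succ_apply, Function.iterate_succ_apply, ← ih]
    rfl

/-! ### The dichotomy -/

lemma polEntropy_le_one_of_escape {g : ℝ × ℝ → ℝ × ℝ}
    (hg : ∀ R, ∃ N, ∀ n ≥ N, ∀ x, ‖x‖ ≤ R → R < ‖g^[n] x‖) : polEntropy (onePointExtend g) ≤ 1 := by
  classical
  refine polEntropy_le_one fun ε hε ↦ ?_
  set R := max 1 (1 / (ε / 2)) with hR
  obtain ⟨M, hM⟩ := hg R
  obtain ⟨N, c, hc⟩ := exists_finite_classification hε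
  set F := onePointExtend g with hF
  set K : Set (OnePoint (ℝ × ℝ)) := {x | ∃ w : ℝ × ℝ, x = w ∧ ‖w‖ ≤ R} with hK
  have hKc : ∀ x, x ∉ K → ‖spherePoint x‖ < ε / 2 := by
    intro x hx
    induction x using OnePoint.rec with
    | infty => simpa [spherePoint_infty] using hε
    | coe w =>
      refine norm_spherePoint_lt (by positivity) (not_lt.1 fun h ↦ hx ⟨w, rfl, h.le⟩)
  have hKd : ∀ x y, x ∉ K → y ∉ K → dist x y ≤ ε := by
    intro x y hx hy
    rw [dist_onePoint]
    linarith [dist_le_norm_add_norm (spherePoint x) (spherePoint y), hKc x hx, hKc y hy]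
  have hKM : ∀ x ∈ K, ∀ k ≥ M, F^[k] x ∉ K := by
    rintro _ ⟨w, rfl, hw⟩ k hk ⟨v, hv, hvR⟩
    rw [hF, onePointExtend_iterate_coe, OnePoint.coe_eq_coe] at hv
    exact (hM k hk w hw).not_ge (hv ▸ hvR)
  refine ⟨N ^ M, fun n ↦ ?_⟩
  have hex : ∀ x, ∃ t, F^[t] x ∈ K ∨ n ≤ t := fun x ↦ ⟨n, Or.inr le_rfl⟩
  have hlt : ∀ x, Nat.find (hex x) < n + 1 := fun x ↦
    Nat.lt_succ_of_le (Nat.find_min' (hex x) (Or.inr le_rfl))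
  have := maxSep_le_card (f := F) (n := n) (ε := ε)
    (fun x ↦ ((⟨Nat.find (hex x), hlt x⟩ : Fin (n + 1)),
      fun k : Fin M ↦ c (F^[k] (F^[Nat.find (hex x)] x)))) ?_
  · simpa [mul_comm] using this
  intro x y hxy k hk
  obtain ⟨h1, h2⟩ := Prod.mk.inj hxy
  have ht : Nat.find (hex x) = Nat.find (hex y) := Fin.mk.inj h1
  by_cases hkt : k < Nat.find (hex x)
  · exact hKd _ _ (fun h ↦ Nat.find_min (hex x) hkt (Or.inl h))
      fun h ↦ Nat.find_min (hex y) (ht ▸ hkt) (Or.inl h)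
  have hx := (Nat.find_spec (hex x)).resolve_right (by omega)
  have hy := (Nat.find_spec (hex y)).resolve_right (by omega)
  rw [← ht] at h2 hy
  obtain ⟨l, rfl⟩ : ∃ l, k = l + Nat.find (hex x) := ⟨k - Nat.find (hex x), by omega⟩
  rw [Function.iterate_add_apply, Function.iterate_add_apply]
  by_cases hl : l < M
  · exact hc _ _ (congrFun h2 ⟨l, hl⟩)
  · exact hKd _ _ (hKM _ hx l (by omega)) (hKM _ hy l (by omega))

lemma exists_free_ball {f : (ℝ × ℝ) ≃ₜ (ℝ × ℝ)} {x : ℝ × ℝ} (hx : f x ≠ x) :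
    ∃ r > 0, ∀ z ∈ Metric.ball x r, f z ∉ Metric.ball x r := by
  obtain ⟨A, B, hA, hB, hxA, hxB, hAB⟩ := t2_separation hx.symm
  obtain ⟨r, hr, h⟩ := Metric.isOpen_iff.1 (hA.inter (hB.preimage f.continuous)) x ⟨hxA, hxB⟩
  exact ⟨r, hr, fun z hz hz' ↦ Set.disjoint_left.1 hAB (h hz').1 (h hz).2⟩

/-- Around every point there is a free ball whose points at distinct visiting times are
uniformly separated in the sphere. -/
lemma IsBrouwer.exists_separating_ball {f : (ℝ × ℝ) ≃ₜ (ℝ × ℝ)} (hf : IsBrouwer f) (x : ℝ × ℝ) :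
    ∃ ρ > 0, ∃ ε > 0, (∀ z ∈ Metric.ball x ρ, f z ∉ Metric.ball x ρ) ∧
      ∀ (z w : ℝ × ℝ) (a b : ℕ), a ≠ b → f^[a] z ∈ Metric.ball x ρ → f^[b] w ∈ Metric.ball x ρ →
        ε < dist ((onePointExtend f)^[a] z) ((onePointExtend f)^[a] w) := by
  obtain ⟨r, hr, hfree⟩ := exists_free_ball (hf.1 x)
  obtain ⟨ρ, hρ, ε, hε, hsep⟩ := exists_sphere_separation x hr
  have hsub : ∀ z ∈ Metric.ball x ρ, z ∈ Metric.ball x r := fun z hz ↦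
    hsep z hz z (by rw [dist_self]; exact hε.le)
  refine ⟨ρ, hρ, ε, hε, fun z hz hz' ↦ hfree z (hsub z hz) (hsub _ hz'), ?_⟩
  intro z w a b hab hz hw
  by_contra! hle
  rw [onePointExtend_iterate_coe, onePointExtend_iterate_coe] at hle
  have h1 := hsep _ hz _ hle
  have h2 := hsub _ hw
  have hwand : ∀ v ∈ Metric.ball x r, ∀ j, 0 < j → f^[j] v ∉ Metric.ball x r := fun v hv j hj ↦
    hf.iterate_notMem Metric.isOpen_ball (convex_ball x r).isPreconnected hfree hv hj
  rcases lt_or_gt_of_ne hab with h | h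
  · refine hwand _ h1 (b - a) (by omega) ?_
    rwa [← Function.iterate_add_apply, Nat.sub_add_cancel h.le]
  · refine hwand _ h2 (a - b) (by omega) ?_
    rwa [← Function.iterate_add_apply, Nat.sub_add_cancel h.le]

lemma IsBrouwer.two_le_polEntropy_of_recurrence {f : (ℝ × ℝ) ≃ₜ (ℝ × ℝ)} (hf : IsBrouwer f)
    {x y : ℝ × ℝ} (hxy : ∀ U ∈ 𝓝 x, ∀ V ∈ 𝓝 y, ∀ N, ∃ n ≥ N, ∃ u ∈ U, f^[n] u ∈ V) :
    2 ≤ polEntropy (onePointExtend f) := by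
  obtain ⟨ρ, hρ, ε, hε, hU, hUsep⟩ := hf.exists_separating_ball x
  obtain ⟨σ, hσ, η, hη, hV, hVsep⟩ := hf.exists_separating_ball y
  set F := onePointExtend f with hF
  have hrec := hxy _ (Metric.ball_mem_nhds x hρ) _ (Metric.ball_mem_nhds y hσ)
  obtain ⟨n₁, -, hn₁⟩ := hrec 0
  have hall : ∀ d, ∃ u ∈ Metric.ball x ρ, f^[n₁ + 1 + d] u ∈ Metric.ball y σ := by
    intro d
    obtain ⟨m, hm, hm'⟩ := hrec (n₁ + 1 + d + 1)
    exact hf.exists_transition Metric.isOpen_ball (convex_ball x ρ).isPreconnected hU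
      Metric.isOpen_ball (convex_ball y σ).isPreconnected hV (by omega) (by omega) hn₁ hm'
  choose u hu hu' using hall
  set n₀ := n₁ + 1 with hn₀
  obtain ⟨N, c, hc⟩ := exists_finite_classification (lt_min hε hη)
  refine two_le_polEntropy (n₀ := 2 * n₀ + 2) (lt_min hε hη) fun n hn ↦ ?_
  set m := (n - n₀) / 2 with hm
  set z : Fin m × Fin m → ℝ × ℝ := fun q ↦ f.symm^[q.1] (u (m + q.2 - q.1)) with hz
  have hinv : ∀ (a : ℕ) (w : ℝ × ℝ), f^[a] (f.symm^[a] w) = w := fun a w ↦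
    (Function.LeftInverse.iterate f.apply_symm_apply a) w
  have hzU : ∀ q, f^[q.1] (z q) ∈ Metric.ball x ρ := fun q ↦ by
    rw [hz, hinv]
    exact hu _
  have hzV : ∀ q, f^[n₀ + m + q.2] (z q) ∈ Metric.ball y σ := fun q ↦ by
    have : n₀ + m + (q.2 : ℕ) = n₀ + (m + q.2 - q.1) + q.1 := by omega
    rw [this, Function.iterate_add_apply, hz, hinv]
    exact hu' _
  have hsep : ∀ q q', q ≠ q' → ∃ k < n, min ε η <
      dist (F^[k] (z q : OnePoint (ℝ × ℝ))) (F^[k] (z q' : OnePoint (ℝ × ℝ))) := by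
    intro q q' hqq
    by_cases h1 : q.1 = q'.1
    · have h2 : q.2 ≠ q'.2 := fun h2 ↦ hqq (Prod.ext h1 h2)
      refine ⟨n₀ + m + q.2, by omega, (min_le_right _ _).trans_lt (hVsep _ _ _ (n₀ + m + q'.2) ?_
        (hzV q) (hzV q'))⟩
      have := Fin.val_ne_of_ne h2
      omega
    · exact ⟨q.1, by omega, (min_le_left _ _).trans_lt (hUsep _ _ _ q'.1
        (Fin.val_ne_of_ne h1) (hzU q) (hzU q'))⟩
  have hinj : Function.Injective fun q ↦ (z q : OnePoint (ℝ × ℝ)) := by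
    intro q q' hqq
    by_contra hne
    obtain ⟨k, -, hk⟩ := hsep q q' hne
    simp only at hqq
    rw [hqq, dist_self] at hk
    exact hk.not_ge (lt_min hε hη).le
  have hE : IsDynSeparated F n (min ε η)
      ↑(Finset.univ.map ⟨fun q ↦ (z q : OnePoint (ℝ × ℝ)), hinj⟩) := by
    intro p hp p' hp' hne
    simp only [Finset.coe_map, Finset.coe_univ, image_univ, mem_range,
      Function.Embedding.coeFn_mk] at hp hp'
    obtain ⟨q, rfl⟩ := hp
    obtain ⟨q', rfl⟩ := hp'
    exact hsep q q' fun h ↦ hne (by rw [h])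
  have hcard := hE.card_le_maxSep c hc
  rw [Finset.card_map, Finset.card_univ, Fintype.card_prod, Fintype.card_fin] at hcard
  have h4 : n ≤ 4 * m := by omega
  nlinarith

lemma exists_recurrence {g : ℝ × ℝ → ℝ × ℝ} {R : ℝ}
    (hg : ∀ N, ∃ n ≥ N, ∃ x, ‖x‖ ≤ R ∧ ‖g^[n] x‖ ≤ R) :
    ∃ x y, ∀ U ∈ 𝓝 x, ∀ V ∈ 𝓝 y, ∀ N, ∃ n ≥ N, ∃ u ∈ U, g^[n] u ∈ V := by
  choose n hn w hw hw' using hg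
  obtain ⟨⟨x, y⟩, -, φ, hφ, hlim⟩ := ((isCompact_closedBall (0 : ℝ × ℝ) R).prod
    (isCompact_closedBall (0 : ℝ × ℝ) R)).tendsto_subseq
    (x := fun N ↦ (w N, g^[n N] (w N)))
    fun N ↦ ⟨mem_closedBall_zero_iff.2 (hw N), mem_closedBall_zero_iff.2 (hw' N)⟩
  refine ⟨x, y, fun U hU V hV N ↦ ?_⟩
  have := hlim.eventually (prod_mem_nhds hU hV)
  obtain ⟨k, hk, hkN⟩ := (this.and (eventually_ge_atTop N)).exists
  exact ⟨n (φ k), (hkN.trans hφ.le_apply).trans (hn _), w (φ k), hk.1, hk.2⟩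

/-- no Brouwer homeomorphism has polynomial entropy strictly between `1`
and `2`. -/
theorem brouwer_polEntropy_gap (f : (ℝ × ℝ) ≃ₜ (ℝ × ℝ)) (hf : IsBrouwer f) :
    polEntropy (onePointExtend ⇑f) ≤ 1 ∨ 2 ≤ polEntropy (onePointExtend ⇑f) := by
  by_cases h : ∀ R, ∃ N, ∀ n ≥ N, ∀ x, ‖x‖ ≤ R → R < ‖f^[n] x‖
  · exact Or.inl (polEntropy_le_one_of_escape h)
  · push Not at h
    obtain ⟨R, hR⟩ := h
    obtain ⟨x, y, hxy⟩ := exists_recurrence hR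
    exact Or.inr (hf.two_le_polEntropy_of_recurrence hxy)
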